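/- A smallest counterexample contains no 5-cycle of degree at most three. -/

import Mathlib

open SimpleGraph

/-- The degree of a vertex, as the cardinality of its neighbor set. -/
noncomputable def deg {V : Type} (G : SimpleGraph V) (v : V) : ℕ :=
  (G.neighborSet v).ncard

/-- The potential of a finite graph: `5 n(G) - 4 e(G)`. -/
noncomputable def pot {V : Type} [Fintype V] (G : SimpleGraph V) : ℤ :=
  5 * (Fintype.card V : ℤ) - 4 * (G.edgeSet.ncard : ℤ)

/-- A graph is 5/2-critical if it has no homomorphism to the 5-cycle
but every proper subgraph has one. -/
def Critical52 {V : Type} (G : SimpleGraph V) : Prop :=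
  IsEmpty (G →g cycleGraph 5) ∧
  ∀ H : G.Subgraph, H ≠ ⊤ → Nonempty (H.coe →g cycleGraph 5)

/-- The exceptional graph `E₁`: a 9-cycle `0 1 2 3 4 5 6 7 8` together
with a vertex `9` adjacent to `0`, `3` and `6`. -/
def E1 : SimpleGraph (Fin 10) := SimpleGraph.fromEdgeSet
  {s(0,1), s(1,2), s(2,3), s(3,4), s(4,5), s(5,6), s(6,7), s(7,8), s(8,0),
   s(9,0), s(9,3), s(9,6)}

/-- The exceptional graph `E₂`: two 5-cycles `0 1 2 3 4` and `0 1 5 6 7`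
sharing exactly the edge `01`, together with a path `3 8 9 6`. -/
def E2 : SimpleGraph (Fin 10) := SimpleGraph.fromEdgeSet
  {s(0,1), s(1,2), s(2,3), s(3,4), s(4,0),
   s(1,5), s(5,6), s(6,7), s(7,0),
   s(3,8), s(8,9), s(9,6)}

/-- A smallest counterexample: a 5/2-critical graph, not isomorphic to `C₃`, `E₁`, `E₂`,
with potential at least 2, such that every smaller 5/2-critical graph not isomorphic
to `C₃`, `E₁`, `E₂` has potential at most 1. -/
def SmallestCex {V : Type} [Fintype V] (G : SimpleGraph V) : Prop :=
  Critical52 G ∧ IsEmpty (G ≃g cycleGraph 3) ∧ IsEmpty (G ≃g E1) ∧ IsEmpty (G ≃g E2) ∧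
  2 ≤ pot G ∧
  ∀ (m : ℕ) (H : SimpleGraph (Fin m)), Critical52 H →
    IsEmpty (H ≃g cycleGraph 3) → IsEmpty (H ≃g E1) → IsEmpty (H ≃g E2) →
    m < Fintype.card V → pot H ≤ 1

/-- A string: a path of positive length whose endvertices have degree at least 3
and whose internal vertices have degree 2. A `k`-string is a string of length `k+1`. -/
def IsString {V : Type} (G : SimpleGraph V) {u v : V} (p : G.Walk u v) : Prop :=
  p.IsPath ∧ 0 < p.length ∧ 3 ≤ deg G u ∧ 3 ≤ deg G v ∧
  ∀ w ∈ p.support, w ≠ u → w ≠ v → deg G w = 2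

/-- `v` lies on a 5-cycle of `G`. -/
def InFiveCycle {V : Type} (G : SimpleGraph V) (v : V) : Prop :=
  ∃ (w : V) (c : G.Walk w w), c.IsCycle ∧ c.length = 5 ∧ v ∈ c.support

/-- `v` is a `(k₁,k₂,k₃)`-vertex: it has degree 3 and is the end of a `k₁`-string,
a `k₂`-string and a `k₃`-string leaving `v` through its three distinct edges. -/
def IsVertex3 {V : Type} (G : SimpleGraph V) (v : V) (k1 k2 k3 : ℕ) : Prop :=
  deg G v = 3 ∧ ∃ (u1 u2 u3 : V) (p1 : G.Walk v u1) (p2 : G.Walk v u2) (p3 : G.Walk v u3),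
    IsString G p1 ∧ IsString G p2 ∧ IsString G p3 ∧
    p1.getVert 1 ≠ p2.getVert 1 ∧ p1.getVert 1 ≠ p3.getVert 1 ∧ p2.getVert 1 ≠ p3.getVert 1 ∧
    p1.length = k1 + 1 ∧ p2.length = k2 + 1 ∧ p3.length = k3 + 1

/-- `v` is a `(k₁,k₂,k₃,k₄)`-vertex: it has degree 4 and is the end of strings of the
corresponding lengths leaving `v` through its four distinct edges. -/
def IsVertex4 {V : Type} (G : SimpleGraph V) (v : V) (k1 k2 k3 k4 : ℕ) : Prop :=
  deg G v = 4 ∧ ∃ (u1 u2 u3 u4 : V) (p1 : G.Walk v u1) (p2 : G.Walk v u2)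
    (p3 : G.Walk v u3) (p4 : G.Walk v u4),
    IsString G p1 ∧ IsString G p2 ∧ IsString G p3 ∧ IsString G p4 ∧
    p1.getVert 1 ≠ p2.getVert 1 ∧ p1.getVert 1 ≠ p3.getVert 1 ∧ p1.getVert 1 ≠ p4.getVert 1 ∧
    p2.getVert 1 ≠ p3.getVert 1 ∧ p2.getVert 1 ≠ p4.getVert 1 ∧ p3.getVert 1 ≠ p4.getVert 1 ∧
    p1.length = k1 + 1 ∧ p2.length = k2 + 1 ∧ p3.length = k3 + 1 ∧ p4.length = k4 + 1

/-- `H` contains at least two distinct cycles, where cycles are counted as subgraphs,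
i.e. two cycles are distinct if their edge sets differ. -/
def TwoDistinctCycles {V : Type} (H : SimpleGraph V) : Prop :=
  ∃ (v1 v2 : V) (c1 : H.Walk v1 v1) (c2 : H.Walk v2 v2),
    c1.IsCycle ∧ c2.IsCycle ∧ {e | e ∈ c1.edges} ≠ {e | e ∈ c2.edges}

/-- The degree of a 5-cycle (cell) `c` in `G`: the number of strings not contained in `c`
that intersect `c`, strings being counted by their edge sets. -/
noncomputable def cellDegree {V : Type} (G : SimpleGraph V) {w : V} (c : G.Walk w w) : ℕ :=
  {S : Set (Sym2 V) | ∃ (u v : V) (p : G.Walk u v), IsString G p ∧ S = {e | e ∈ p.edges} ∧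
    ¬ S ⊆ {e | e ∈ c.edges} ∧ ∃ x ∈ p.support, x ∈ c.support}.ncard

abbrev A5 (a b : Fin 5) : Prop := a - b = 1 ∨ b - a = 1

lemma A5_iff (a b : Fin 5) : (cycleGraph 5).Adj a b ↔ A5 a b := by
  exact cycleGraph_adj (n := 3)

lemma A5_symm {a b : Fin 5} (h : A5 a b) : A5 b a := h.symm

section Pot
open Classical in
/-- number of ordered adjacent pairs -/
noncomputable def ee {V : Type} (G : SimpleGraph V) (A B : Finset V) : ℤ :=
  ∑ a ∈ A, ∑ b ∈ B, if G.Adj a b then 1 else 0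

noncomputable def PP {V : Type} (G : SimpleGraph V) (A : Finset V) : ℤ :=
  5 * (A.card : ℤ) - 2 * ee G A A

def IsCol {V : Type} (G : SimpleGraph V) (X : Finset V) (f : V → Fin 5) : Prop :=
  ∀ u ∈ X, ∀ v ∈ X, G.Adj u v → A5 (f u) (f v)

lemma pot_eq {V : Type} [Fintype V] (G : SimpleGraph V) : pot G = PP G Finset.univ := by
  classical
  have h1 : (∑ v, (G.degree v : ℤ)) = 2 * (G.edgeFinset.card : ℤ) := by
    exact_mod_cast G.sum_degrees_eq_twice_card_edges
  have h2 : ee G Finset.univ Finset.univ = ∑ v, (G.degree v : ℤ) := by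
    unfold ee
    apply Finset.sum_congr rfl
    intro v _
    rw [← G.card_neighborFinset_eq_degree, Finset.sum_boole]
    congr 2
    ext u
    simp
  have h3 : G.edgeSet.ncard = G.edgeFinset.card := by
    rw [Set.ncard_eq_toFinset_card']
    rfl
  unfold pot PP
  rw [h2, h1, h3, Finset.card_univ]
  ring

lemma ee_symm {V : Type} (G : SimpleGraph V) (A B : Finset V) : ee G A B = ee G B A := by
  unfold ee
  rw [Finset.sum_comm]
  apply Finset.sum_congr rfl
  intro a _
  apply Finset.sum_congr rfl
  intro b _
  classical
  exact if_congr (G.adj_comm _ _) rfl rfl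

open Classical in
lemma PP_union {V : Type} (G : SimpleGraph V) (A B : Finset V) (h : Disjoint A B) :
    PP G (A ∪ B) = PP G A + PP G B - 4 * ee G A B := by
  have : ee G (A ∪ B) (A ∪ B) = ee G A A + ee G A B + (ee G B A + ee G B B) := by
    unfold ee
    rw [Finset.sum_union h, ← Finset.sum_add_distrib, ← Finset.sum_add_distrib]
    simp only [Finset.sum_union h]
  unfold PP
  rw [this, Finset.card_union_of_disjoint h, ee_symm G B A]
  push_cast
  ring

open Classical in
lemma PP_insert {V : Type} (G : SimpleGraph V) (A : Finset V) (v : V) (hv : v ∉ A) (T : Finset V)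
    (hT : ∀ t ∈ T, t ∈ A ∧ G.Adj v t) :
    PP G (insert v A) ≤ PP G A + 5 - 4 * (T.card : ℤ) := by
  rw [Finset.insert_eq, PP_union G {v} A (by simpa using hv)]
  have h1 : PP G {v} = 5 := by simp [PP, ee]
  have h2 : (T.card : ℤ) ≤ ee G {v} A := by
    simp only [ee, Finset.sum_singleton, Finset.sum_boole]
    norm_cast
    apply Finset.card_le_card
    intro t ht
    simp [hT t ht]
  linarith

lemma fin5_pot : ∀ X : Finset (Fin 5), X.Nonempty →
    5 ≤ 5 * (X.card : ℤ) - 2 * ∑ a ∈ X, ∑ b ∈ X, if A5 a b then 1 else 0 := by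
  decide

open Classical in
lemma PP_inj {V : Type} (G : SimpleGraph V) (S : Finset V) (f : V → Fin 5) (hf : IsCol G S f)
    (hne : S.Nonempty) (hinj : Set.InjOn f S) : 5 ≤ PP G S := by
  have h := fin5_pot (S.image f) (hne.image f)
  rw [Finset.card_image_of_injOn hinj, Finset.sum_image hinj] at h
  have : ee G S S ≤ ∑ a ∈ S, ∑ b ∈ S.image f, if A5 (f a) b then 1 else 0 := by
    unfold ee
    apply Finset.sum_le_sum
    intro a ha
    rw [Finset.sum_image hinj]
    apply Finset.sum_le_sum
    intro b hb
    by_cases hab : G.Adj a b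
    · rw [if_pos hab, if_pos (hf a ha b hb hab)]
    · rw [if_neg hab]
      split_ifs <;> simp
  unfold PP
  linarith

lemma noCol_univ {V : Type} [Fintype V] {G : SimpleGraph V} (h : IsEmpty (G →g cycleGraph 5))
    (f : V → Fin 5) : ¬ IsCol G Finset.univ f := by
  intro hf
  exact h.false ⟨f, fun {a b} hab => (A5_iff _ _).2 (hf a (by simp) b (by simp) hab)⟩

lemma col_of_ne {V : Type} [Fintype V] {G : SimpleGraph V} (h : Critical52 G) (X : Finset V)
    (hX : X ≠ Finset.univ) : ∃ f, IsCol G X f := by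
  classical
  obtain ⟨φ⟩ := h.2 ((⊤ : G.Subgraph).induce (X : Set V)) (by
    intro he
    apply hX
    have := congrArg Subgraph.verts he
    simp only [Subgraph.induce_verts, Subgraph.verts_top] at this
    exact_mod_cast this)
  refine ⟨fun v => if hv : v ∈ X then φ ⟨v, by simpa using hv⟩ else 0, ?_⟩
  intro u hu v hv huv
  simp only [hu, hv, dif_pos]
  rw [← A5_iff]
  apply φ.map_adj
  simp [hu, hv, huv]

lemma PP_dec {m : ℕ} (G : SimpleGraph (Fin m)) (r : Fin m → Fin m → Prop) [DecidableRel r]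
    (h : ∀ a b, G.Adj a b ↔ r a b) :
    PP G Finset.univ = 5 * (m : ℤ) - 2 * ∑ a, ∑ b, if r a b then 1 else 0 := by
  unfold PP ee
  simp [h]

def E1r (a b : Fin 10) : Prop := (a = 0 ∧ b = 1) ∨ (a = 1 ∧ b = 2) ∨ (a = 2 ∧ b = 3) ∨
  (a = 3 ∧ b = 4) ∨ (a = 4 ∧ b = 5) ∨ (a = 5 ∧ b = 6) ∨ (a = 6 ∧ b = 7) ∨ (a = 7 ∧ b = 8) ∨
  (a = 8 ∧ b = 0) ∨ (a = 9 ∧ b = 0) ∨ (a = 9 ∧ b = 3) ∨ (a = 9 ∧ b = 6)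

def E2r (a b : Fin 10) : Prop := (a = 0 ∧ b = 1) ∨ (a = 1 ∧ b = 2) ∨ (a = 2 ∧ b = 3) ∨
  (a = 3 ∧ b = 4) ∨ (a = 4 ∧ b = 0) ∨ (a = 1 ∧ b = 5) ∨ (a = 5 ∧ b = 6) ∨ (a = 6 ∧ b = 7) ∨
  (a = 7 ∧ b = 0) ∨ (a = 3 ∧ b = 8) ∨ (a = 8 ∧ b = 9) ∨ (a = 9 ∧ b = 6)

instance : DecidableRel E1r := fun a b => by unfold E1r; infer_instance
instance : DecidableRel E2r := fun a b => by unfold E2r; infer_instance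

lemma E1_adj (a b : Fin 10) : E1.Adj a b ↔ (E1r a b ∨ E1r b a) := by
  simp only [E1, fromEdgeSet_adj, Set.mem_insert_iff, Set.mem_singleton_iff, Sym2.eq_iff]
  revert a b
  decide +kernel

lemma E2_adj (a b : Fin 10) : E2.Adj a b ↔ (E2r a b ∨ E2r b a) := by
  simp only [E2, fromEdgeSet_adj, Set.mem_insert_iff, Set.mem_singleton_iff, Sym2.eq_iff]
  revert a b
  decide +kernel

lemma E1_pot : PP E1 Finset.univ = 2 := by
  rw [PP_dec E1 (fun a b => E1r a b ∨ E1r b a) E1_adj]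
  decide +kernel

lemma E2_pot : PP E2 Finset.univ = 2 := by
  rw [PP_dec E2 (fun a b => E2r a b ∨ E2r b a) E2_adj]
  decide +kernel

lemma C3_adj (a b : Fin 3) : (cycleGraph 3).Adj a b ↔ (a - b = 1 ∨ b - a = 1) :=
  cycleGraph_adj (n := 1)

lemma C3_pot : PP (cycleGraph 3) Finset.univ = 3 := by
  rw [PP_dec _ (fun a b => (a - b = 1 ∨ b - a = 1)) C3_adj]
  decide

lemma PP_iso {V W : Type} [Fintype V] [Fintype W] {G : SimpleGraph V} {H : SimpleGraph W}
    (e : G ≃g H) : PP G Finset.univ = PP H Finset.univ := by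
  classical
  unfold PP ee
  rw [Finset.card_univ, Finset.card_univ, Fintype.card_congr e.toEquiv]
  congr 2
  rw [← Equiv.sum_comp e.toEquiv]
  apply Finset.sum_congr rfl
  intro v _
  rw [← Equiv.sum_comp e.toEquiv]
  apply Finset.sum_congr rfl
  intro u _
  have : H.Adj (e.toEquiv v) (e.toEquiv u) ↔ G.Adj v u := e.map_adj_iff
  simp only [this]
end Pot

lemma red {V : Type} [Fintype V] {G : SimpleGraph V} (h : SmallestCex G) (Gs : SimpleGraph V)
    (R : Finset V) (hR : R ≠ Finset.univ) (hno : ∀ f, ¬ IsCol Gs R f) :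
    ∃ X ⊆ R, (∀ f, ¬ IsCol Gs X f) ∧ (PP Gs X ≤ 2 ∨ (PP Gs X ≤ 3 ∧
      ∃ a b c, X = ({a, b, c} : Set V) ∧ Gs.Adj a b ∧ Gs.Adj b c ∧ Gs.Adj a c)) := by
  classical
  let Q : ℕ → Prop := fun m => ∃ (g : Fin m → V), Function.Injective g ∧ (∀ i, g i ∈ R) ∧
    IsEmpty ((Gs.comap g) →g cycleGraph 5)
  have hQ : ∃ m, Q m := by
    refine ⟨R.card, fun i => (R.equivFin.symm i : V), ?_, fun i => (R.equivFin.symm i).2, ⟨?_⟩⟩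
    · intro i j hij
      exact R.equivFin.symm.injective (Subtype.ext hij)
    · intro φ
      apply hno (fun v => if hv : v ∈ R then φ (R.equivFin ⟨v, hv⟩) else 0)
      intro u hu v hv huv
      simp only [hu, hv, dif_pos]
      rw [← A5_iff]
      apply φ.map_adj
      simpa using huv
  obtain ⟨g, ginj, gR, gno⟩ := Nat.find_spec hQ
  have hmin : ∀ k, k < Nat.find hQ → ¬ Q k := fun k hk => Nat.find_min hQ hk
  have hcard : Nat.find hQ ≤ R.card := by
    have := Finset.card_le_card (s := Finset.univ.image g) (t := R) (by
      intro v hv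
      simp only [Finset.mem_image, Finset.mem_univ, true_and] at hv
      obtain ⟨i, rfl⟩ := hv
      exact gR i)
    rwa [Finset.card_image_of_injective _ ginj, Finset.card_univ, Fintype.card_fin] at this
  generalize Nat.find hQ = m at *
  obtain ⟨H, ⟨hHle, hHno⟩, hHmin⟩ := WellFounded.has_min (wellFounded_lt (α := SimpleGraph (Fin m)))
    {H | H ≤ Gs.comap g ∧ IsEmpty (H →g cycleGraph 5)} ⟨_, le_rfl, gno⟩
  have hcrit : Critical52 H := by
    refine ⟨hHno, ?_⟩
    intro H' hH'
    by_contra hcon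
    rw [not_nonempty_iff] at hcon
    by_cases hv : H'.verts = Set.univ
    · have hlt : H'.spanningCoe < H := by
        refine lt_of_le_of_ne H'.spanningCoe_le ?_
        intro he
        apply hH'
        ext u v
        · simp [hv]
        · rw [← Subgraph.spanningCoe_adj, he]
          simp
      apply hHmin H'.spanningCoe ⟨le_trans hlt.le hHle, ⟨?_⟩⟩ hlt
      intro φ
      exact hcon.false ⟨fun v => φ v.1, fun {a b} hab => φ.map_adj (by simpa using hab)⟩
    · have hc : Fintype.card H'.verts < m := by
        have := Fintype.card_subtype_lt (p := fun x => x ∈ H'.verts) (x := ((Set.ne_univ_iff_exists_notMem _).1 hv).choose)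
          ((Set.ne_univ_iff_exists_notMem _).1 hv).choose_spec
        simpa using this
      apply hmin _ hc
      let e := Fintype.equivFin H'.verts
      refine ⟨fun i => g (e.symm i).1, ?_, fun i => gR _, ⟨?_⟩⟩
      · intro i j hij
        exact e.symm.injective (Subtype.ext (ginj hij))
      · intro φ
        refine hcon.false ⟨fun v => φ (e v), fun {a b} hab => φ.map_adj ?_⟩
        have := hHle (H'.coe_adj_sub a b hab)
        simpa using this
  have hmV : m < Fintype.card V := lt_of_le_of_lt hcard (by
    rw [← Finset.card_univ]
    exact Finset.card_lt_card (Finset.ssubset_univ_iff.2 hR))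
  have hPP : PP Gs (Finset.univ.image g) ≤ PP H Finset.univ := by
    unfold PP
    rw [Finset.card_image_of_injective _ ginj]
    have : ee H Finset.univ Finset.univ ≤ ee Gs (Finset.univ.image g) (Finset.univ.image g) := by
      unfold ee
      rw [Finset.sum_image ginj.injOn]
      apply Finset.sum_le_sum
      intro i _
      rw [Finset.sum_image ginj.injOn]
      apply Finset.sum_le_sum
      intro j _
      by_cases hij : H.Adj i j
      · rw [if_pos hij, if_pos (show Gs.Adj (g i) (g j) from hHle hij)]
      · rw [if_neg hij]
        split_ifs <;> simp
    linarith
  refine ⟨Finset.univ.image g, ?_, ?_, ?_⟩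
  · intro v hv
    simp only [Finset.mem_image, Finset.mem_univ, true_and] at hv
    obtain ⟨i, rfl⟩ := hv
    exact gR i
  · intro f hf
    refine gno.false ⟨f ∘ g, fun {a b} hab => (A5_iff _ _).2 (hf _ (by simp) _ (by simp) hab)⟩
  · by_cases h3 : IsEmpty (H ≃g cycleGraph 3)
    · left
      by_cases h1 : IsEmpty (H ≃g E1)
      · by_cases h2 : IsEmpty (H ≃g E2)
        · have := h.2.2.2.2.2 m H hcrit h3 h1 h2 hmV
          rw [pot_eq] at this
          linarith
        · rw [not_isEmpty_iff] at h2
          obtain ⟨e⟩ := h2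
          have := PP_iso e
          rw [E2_pot] at this
          linarith
      · rw [not_isEmpty_iff] at h1
        obtain ⟨e⟩ := h1
        have := PP_iso e
        rw [E1_pot] at this
        linarith
    · right
      rw [not_isEmpty_iff] at h3
      obtain ⟨e⟩ := h3
      have := PP_iso e
      rw [C3_pot] at this
      refine ⟨by linarith, g (e.symm 0), g (e.symm 1), g (e.symm 2), ?_, ?_, ?_, ?_⟩
      · ext v
        simp only [Finset.coe_image, Finset.coe_univ, Set.image_univ, Set.mem_range,
          Set.mem_insert_iff, Set.mem_singleton_iff]
        constructor
        · rintro ⟨i, rfl⟩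
          have : e i = 0 ∨ e i = 1 ∨ e i = 2 := by
            generalize e i = j
            revert j
            decide
          rcases this with hh | hh | hh <;> simp [← hh]
        · rintro (rfl | rfl | rfl) <;> simp
      all_goals
        apply hHle
        rw [e.symm.map_adj_iff, C3_adj]
        decide

open Classical in
/-- main identification step of the potential method -/
lemma potStep {V : Type} [Fintype V] {G : SimpleGraph V} (h : SmallestCex G)
    (S : Finset V) (hS : S ≠ Finset.univ) (f : V → Fin 5) (hf : IsCol G S f)
    (hninj : ¬ Set.InjOn f S) :
    ∃ X0 : Finset V, X0.Nonempty ∧ Disjoint S X0 ∧ ((PP G (S ∪ X0) ≤ PP G S - 3) ∨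
      (PP G (S ∪ X0) ≤ PP G S - 2 ∧ ∃ a b w w', a ∉ S ∧ b ∉ S ∧ w ∈ S ∧ w' ∈ S ∧
        X0 = {a, b} ∧ G.Adj a b ∧ G.Adj a w ∧ G.Adj b w' ∧ f w = f w')) := by
  have hrep : ∃ rep : V → V, ∀ v ∈ S, rep v ∈ S ∧ f (rep v) = f v ∧
      ∀ u ∈ S, f u = f v → rep u = rep v := by
    refine ⟨fun v => if hv : ∃ u ∈ S, f u = f v then hv.choose else v, ?_⟩
    intro v hv
    have hex : ∃ u ∈ S, f u = f v := ⟨v, hv, rfl⟩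
    refine ⟨?_, ?_, ?_⟩
    · simp only [hex, dif_pos]
      exact hex.choose_spec.1
    · simp only [hex, dif_pos]
      exact hex.choose_spec.2
    · intro u hu huv
      simp only [huv]
      simp only [hex, dif_pos]
  obtain ⟨rep, hrep⟩ := hrep
  let q : V → V := fun v => if v ∈ S then rep v else v
  have q1 : ∀ v ∈ S, q v = rep v := fun v hv => if_pos hv
  have q2 : ∀ v, v ∉ S → q v = v := fun v hv => if_neg hv
  have qS : ∀ v, q v ∈ S ↔ v ∈ S := by
    intro v
    by_cases hv : v ∈ S
    · simp [q1 v hv, hv, (hrep v hv).1]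
    · simp [q2 v hv, hv]
  have qf : ∀ v ∈ S, f (q v) = f v := fun v hv => by rw [q1 v hv]; exact (hrep v hv).2.1
  have qeq : ∀ u ∈ S, ∀ v ∈ S, f u = f v → q u = q v := fun u hu v hv huv => by
    rw [q1 u hu, q1 v hv]; exact (hrep v hv).2.2 u hu huv
  have qne : ∀ u v, G.Adj u v → q u ≠ q v := by
    intro u v huv he
    by_cases hu : u ∈ S
    · have hv : v ∈ S := by rw [← qS, ← he, qS]; exact hu
      have h1 := hf u hu v hv huv
      rw [← qf u hu, ← qf v hv, he] at h1
      revert h1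
      generalize f (q v) = c
      revert c
      decide
    · have hv : v ∉ S := by rw [← qS, ← he, qS]; exact hu
      rw [q2 u hu, q2 v hv] at he
      exact huv.ne he
  obtain ⟨Gs, hGs⟩ : ∃ Gs : SimpleGraph V,
      ∀ a b, Gs.Adj a b ↔ ∃ u v, q u = a ∧ q v = b ∧ G.Adj u v :=
    ⟨{ Adj := fun a b => ∃ u v, q u = a ∧ q v = b ∧ G.Adj u v
       symm := ⟨fun a b ⟨u, v, h1, h2, h3⟩ => ⟨v, u, h2, h1, h3.symm⟩⟩
       loopless := ⟨fun a ⟨u, v, h1, h2, h3⟩ => qne u v h3 (h1.trans h2.symm)⟩ },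
      fun _ _ => Iff.rfl⟩
  obtain ⟨X, hXR, hXno, hX⟩ := red h Gs (Finset.univ.image q) (by
    intro he
    have hsurj : Function.Surjective q := by
      intro v
      have : v ∈ Finset.univ.image q := by rw [he]; simp
      simpa using this
    have hinj := Finite.injective_iff_surjective.2 hsurj
    exact hninj (fun u hu v hv huv => hinj (qeq u hu v hv huv))) (by
    intro g hg
    apply noCol_univ h.1.1 (g ∘ q)
    intro u _ v _ huv
    exact hg (q u) (by simp) (q v) (by simp) ((hGs _ _).2 ⟨u, v, rfl, rfl, huv⟩))
  have hXrep : ∀ v ∈ X, v ∈ S → q v = v := by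
    intro v hv hvS
    have := hXR hv
    simp only [Finset.mem_image, Finset.mem_univ, true_and] at this
    obtain ⟨u, rfl⟩ := this
    have hu := (qS u).1 hvS
    exact qeq _ hvS _ hu (qf u hu)
  let XS := X.filter (· ∈ S)
  let X0 := X.filter (· ∉ S)
  have hXu : X = XS ∪ X0 := (Finset.filter_union_filter_not_eq _ _).symm
  have hXd : Disjoint XS X0 := Finset.disjoint_filter_filter_not _ _ _
  have hSd : Disjoint S X0 := by
    rw [Finset.disjoint_left]
    intro v hv hv'
    exact (Finset.mem_filter.1 hv').2 hv
  have hXScol : IsCol Gs XS f := by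
    intro a ha b hb hab
    obtain ⟨u, v, rfl, rfl, huv⟩ := (hGs _ _).1 hab
    have hu := (qS u).1 (Finset.mem_filter.1 ha).2
    have hv := (qS v).1 (Finset.mem_filter.1 hb).2
    rw [qf u hu, qf v hv]
    exact hf u hu v hv huv
  have hXSinj : Set.InjOn f XS := by
    intro a ha b hb hab
    have ha := Finset.mem_filter.1 ha
    have hb := Finset.mem_filter.1 hb
    rw [← hXrep a ha.1 ha.2, ← hXrep b hb.1 hb.2]
    exact qeq a ha.2 b hb.2 hab
  have hX0ne : X0.Nonempty := by
    by_contra hne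
    rw [Finset.not_nonempty_iff_eq_empty] at hne
    rw [hne, Finset.union_empty] at hXu
    exact hXno f (hXu ▸ hXScol)
  have hadj0 : ∀ a b, a ∉ S → b ∉ S → (Gs.Adj a b ↔ G.Adj a b) := by
    intro a b ha hb
    rw [hGs]
    constructor
    · rintro ⟨u, v, rfl, rfl, huv⟩
      rw [qS] at ha hb
      rwa [q2 u ha, q2 v hb]
    · intro hab
      exact ⟨a, b, q2 a ha, q2 b hb, hab⟩
  have hadjS : ∀ a b, a ∈ S → b ∉ S → Gs.Adj a b → ∃ u ∈ S, q u = a ∧ G.Adj u b := by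
    intro a b ha hb hab
    obtain ⟨u, v, rfl, rfl, huv⟩ := (hGs _ _).1 hab
    rw [qS] at ha hb
    exact ⟨u, ha, rfl, by rwa [q2 v hb]⟩
  have hXSne : XS.Nonempty := by
    by_contra hne
    rw [Finset.not_nonempty_iff_eq_empty] at hne
    have hXS : ∀ v ∈ X, v ∉ S := by
      intro v hv hvS
      have : v ∈ XS := Finset.mem_filter.2 ⟨hv, hvS⟩
      rw [hne] at this
      simp at this
    have hSne : S.Nonempty := by
      by_contra hSe
      rw [Finset.not_nonempty_iff_eq_empty] at hSe
      apply hninj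
      simp [hSe]
    obtain ⟨s, hs⟩ := hSne
    obtain ⟨g, hg⟩ := col_of_ne h.1 X (by
      intro he
      exact hXS s (he ▸ Finset.mem_univ s) hs)
    exact hXno g (fun u hu v hv huv => hg u hu v hv ((hadj0 u v (hXS u hu) (hXS v hv)).1 huv))
  have hPXS : 5 ≤ PP Gs XS := PP_inj Gs XS f hXScol hXSne hXSinj
  have he0 : PP Gs X0 = PP G X0 := by
    unfold PP ee
    congr 2
    apply Finset.sum_congr rfl
    intro a ha
    apply Finset.sum_congr rfl
    intro b hb
    exact if_congr (hadj0 a b (Finset.mem_filter.1 ha).2 (Finset.mem_filter.1 hb).2) rfl rfl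
  have heS : ee Gs XS X0 ≤ ee G S X0 := by
    rw [ee_symm Gs, ee_symm G]
    unfold ee
    apply Finset.sum_le_sum
    intro b hb
    simp only [Finset.sum_boole]
    norm_cast
    have hb := Finset.mem_filter.1 hb
    have : (XS.filter (fun a => Gs.Adj b a)) ⊆ (S.filter (fun a => G.Adj b a)).image q := by
      intro a ha
      rw [Finset.mem_filter] at ha
      obtain ⟨u, hu, huq, hub⟩ := hadjS a b (Finset.mem_filter.1 ha.1).2 hb.2 ha.2.symm
      rw [Finset.mem_image]
      exact ⟨u, Finset.mem_filter.2 ⟨hu, hub.symm⟩, huq⟩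
    exact (Finset.card_le_card this).trans Finset.card_image_le
  have hc1 := PP_union G S X0 hSd
  have hc2 := PP_union Gs XS X0 hXd
  rw [← hXu] at hc2
  refine ⟨X0, hX0ne, hSd, ?_⟩
  rcases hX with hX | ⟨hX, a, b, c, habc, hab, hbc, hac⟩
  · left
    linarith
  by_cases h6 : 6 ≤ PP Gs XS
  · left
    linarith
  right
  refine ⟨by linarith, ?_⟩
  have hX' : X = {a, b, c} := by
    apply Finset.coe_injective
    rw [habc]
    simp
  -- no two adjacent vertices in XS
  have hno2 : ∀ r s, Gs.Adj r s → (∀ t ∈ XS, t = r ∨ t = s) → r ∈ XS → s ∈ XS → False := by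
    intro r s hrs ht hr hs
    apply h6
    have : XS = {r, s} := by
      ext t
      simp only [Finset.mem_insert, Finset.mem_singleton]
      constructor
      · exact ht t
      · rintro (rfl | rfl) <;> assumption
    rw [this]
    have h1 : ({r, s} : Finset V).card = 2 := Finset.card_pair hrs.ne
    unfold PP ee
    rw [h1, Finset.sum_pair hrs.ne, Finset.sum_pair hrs.ne, Finset.sum_pair hrs.ne]
    simp [hrs, hrs.symm]
  have key : ∀ r s t, X = {r, s, t} → Gs.Adj r s → Gs.Adj s t → Gs.Adj r t → r ∈ S →
      s ∉ S → t ∉ S → 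
      ∃ a b w w', a ∉ S ∧ b ∉ S ∧ w ∈ S ∧ w' ∈ S ∧
        X0 = {a, b} ∧ G.Adj a b ∧ G.Adj a w ∧ G.Adj b w' ∧ f w = f w' := by
    intro r s t hX hrs hst hrt hr hs ht
    obtain ⟨w, hw, hwr, hws⟩ := hadjS r s hr hs hrs
    obtain ⟨w', hw', hwr', hws'⟩ := hadjS r t hr ht hrt
    refine ⟨s, t, w, w', hs, ht, hw, hw', ?_, (hadj0 s t hs ht).1 hst, hws.symm, hws'.symm, ?_⟩
    · ext v
      simp only [X0, hX, Finset.mem_filter, Finset.mem_insert, Finset.mem_singleton]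
      constructor
      · rintro ⟨rfl | rfl | rfl, hv⟩
        · exact absurd hr hv
        · simp
        · simp
      · rintro (rfl | rfl)
        · simp [hs]
        · simp [ht]
    · rw [← qf w hw, ← qf w' hw', hwr, hwr']
  have hmem : ∀ t, t ∈ XS ↔ (t = a ∨ t = b ∨ t = c) ∧ t ∈ S := by
    intro t
    simp only [XS, hX', Finset.mem_filter, Finset.mem_insert, Finset.mem_singleton]
  have hmem0 : ∀ t, t ∈ X0 ↔ (t = a ∨ t = b ∨ t = c) ∧ t ∉ S := by
    intro t
    simp only [X0, hX', Finset.mem_filter, Finset.mem_insert, Finset.mem_singleton]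
  obtain ⟨x0, hx0⟩ := hX0ne
  obtain ⟨xS, hxS⟩ := hXSne
  rw [hmem0] at hx0
  rw [hmem] at hxS
  have n1 := hno2 a b hab
  have n2 := hno2 b c hbc
  have n3 := hno2 a c hac
  simp only [hmem] at n1 n2 n3
  by_cases ha : a ∈ S <;> by_cases hb : b ∈ S <;> by_cases hc : c ∈ S
  · exfalso
    rcases hx0 with ⟨rfl | rfl | rfl, hh⟩ <;> contradiction
  · exfalso
    refine n1 ?_ (by simp [ha]) (by simp [hb])
    rintro t ⟨rfl | rfl | rfl, hh⟩
    · simp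
    · simp
    · contradiction
  · exfalso
    refine n3 ?_ (by simp [ha]) (by simp [hc])
    rintro t ⟨rfl | rfl | rfl, hh⟩
    · simp
    · contradiction
    · simp
  · exact key a b c hX' hab hbc hac ha hb hc
  · exfalso
    refine n2 ?_ (by simp [hb]) (by simp [hc])
    rintro t ⟨rfl | rfl | rfl, hh⟩
    · contradiction
    · simp
    · simp
  · refine key b a c ?_ hab.symm hac hbc hb ha hc
    rw [hX', Finset.insert_comm]
  · refine key c a b ?_ hac.symm hab hbc.symm hc ha hb
    rw [hX', Finset.pair_comm b c, Finset.insert_comm a c]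
  · exfalso
    rcases hxS with ⟨rfl | rfl | rfl, hh⟩ <;> contradiction

open Classical in
lemma pot_ge_four {V : Type} [Fintype V] {G : SimpleGraph V} (h : SmallestCex G) :
    ∀ (k : ℕ) (S : Finset V), Sᶜ.card ≤ k → S ≠ Finset.univ → S.Nonempty → 4 ≤ PP G S := by
  intro k
  induction k with
  | zero =>
    intro S hS hne
    exfalso
    apply hne
    simpa using hS
  | succ k ih =>
    intro S hS hne hSne
    obtain ⟨f, hf⟩ := col_of_ne h.1 S hne
    by_cases hinj : Set.InjOn f S
    · have := PP_inj G S f hf hSne hinj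
      linarith
    · obtain ⟨X0, ⟨x, hx⟩, hd, hX⟩ := potStep h S hne f hf hinj
      have h2 : PP G (S ∪ X0) ≤ PP G S - 2 := by
        rcases hX with hX | hX
        · linarith
        · exact hX.1
      by_cases hu : S ∪ X0 = Finset.univ
      · have := h.2.2.2.2.1
        rw [pot_eq, ← hu] at this
        linarith
      · have := ih (S ∪ X0) (by
          have : (S ∪ X0)ᶜ ⊂ Sᶜ := by
            rw [Finset.ssubset_iff_of_subset]
            · refine ⟨x, ?_, ?_⟩
              · rw [Finset.mem_compl]
                exact Finset.disjoint_right.1 hd hx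
              · simp [hx]
            · intro v hv
              simp only [Finset.mem_compl, Finset.mem_union] at *
              tauto
          have := Finset.card_lt_card this
          omega) hu (hSne.mono Finset.subset_union_left)
        linarith

open Classical in
lemma pot_four {V : Type} [Fintype V] {G : SimpleGraph V} (h : SmallestCex G) 
    (S : Finset V) (hS : S ≠ Finset.univ) (hSne : S.Nonempty) (f : V → Fin 5) (hf : IsCol G S f)
    (hninj : ¬ Set.InjOn f S) (hp : PP G S ≤ 4) :
    ∃ a b w w', a ∉ S ∧ b ∉ S ∧ w ∈ S ∧ w' ∈ S ∧ (∀ v, v ∈ S ∨ v = a ∨ v = b) ∧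
      G.Adj a b ∧ G.Adj a w ∧ G.Adj b w' ∧ f w = f w' ∧
      (∀ u ∈ S, G.Adj a u → u = w) ∧ (∀ u ∈ S, G.Adj b u → u = w') := by
  have hge := fun S => pot_ge_four h _ S le_rfl
  obtain ⟨X0, ⟨x, hx⟩, hd, hX⟩ := potStep h S hS f hf hninj
  have hu : S ∪ X0 = Finset.univ := by
    by_contra hu
    have := hge (S ∪ X0) hu (hSne.mono Finset.subset_union_left)
    rcases hX with hX | ⟨hX, _⟩ <;> linarith
  have hpot := h.2.2.2.2.1
  rw [pot_eq, ← hu] at hpot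
  rcases hX with hX | ⟨hX, a, b, w, w', ha, hb, hw, hw', hX0, hab, haw, hbw, hff⟩
  · linarith
  have huniq : ∀ a b w, a ∉ S → b ∉ S → G.Adj a b → w ∈ S → G.Adj a w →
      ∀ u ∈ S, G.Adj a u → u = w := by
    intro a b w ha hb hab hw haw u hu hau
    by_contra hne
    have h1 := PP_insert G S a ha {u, w} (by
      intro t ht
      simp only [Finset.mem_insert, Finset.mem_singleton] at ht
      rcases ht with rfl | rfl
      · exact ⟨hu, hau⟩
      · exact ⟨hw, haw⟩)
    rw [Finset.card_pair hne] at h1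
    have h2 := hge (insert a S) (by
      intro he
      have : b ∈ insert a S := by rw [he]; simp
      simp only [Finset.mem_insert] at this
      rcases this with rfl | hh
      · exact hab.ne rfl
      · exact hb hh) (by simp)
    push_cast at h1
    linarith
  refine ⟨a, b, w, w', ha, hb, hw, hw', ?_, hab, haw, hbw, hff, 
    huniq a b w ha hb hab hw haw, huniq b a w' hb ha hab.symm hw' hbw⟩
  intro v
  have : v ∈ S ∪ X0 := by rw [hu]; simp
  simp only [hX0, Finset.mem_union, Finset.mem_insert, Finset.mem_singleton] at this
  exact this

lemma isoOf {V : Type} [Fintype V] {G : SimpleGraph V} {m : ℕ} (H : SimpleGraph (Fin m))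
    (g : Fin m → V) (hg : Function.Bijective g) (hom : ∀ i j, H.Adj i j → G.Adj (g i) (g j))
    (hp : PP H Finset.univ ≤ PP G Finset.univ + 1) : Nonempty (G ≃g H) := by
  classical
  let e := Equiv.ofBijective g hg
  have key : ∀ i j, G.Adj (g i) (g j) → H.Adj i j := by
    intro i j hij
    by_contra hH
    have h1 : ee H Finset.univ Finset.univ < ee G Finset.univ Finset.univ := by
      unfold ee
      rw [← Equiv.sum_comp e (fun a => ∑ b, if G.Adj a b then (1 : ℤ) else 0)]
      have hle : ∀ i j, (if H.Adj i j then (1 : ℤ) else 0) ≤ if G.Adj (e i) (e j) then 1 else 0 := by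
        intro i j
        by_cases h : H.Adj i j
        · rw [if_pos h, if_pos (show G.Adj (e i) (e j) from hom i j h)]
        · rw [if_neg h]
          split_ifs <;> simp
      apply Finset.sum_lt_sum
      · intro i _
        rw [← Equiv.sum_comp e (fun b => if G.Adj (e i) b then (1 : ℤ) else 0)]
        exact Finset.sum_le_sum (fun j _ => hle i j)
      · refine ⟨i, by simp, ?_⟩
        rw [← Equiv.sum_comp e (fun b => if G.Adj (e i) b then (1 : ℤ) else 0)]
        refine Finset.sum_lt_sum (fun j _ => hle i j) ⟨j, by simp, ?_⟩
        rw [if_neg hH, if_pos (show G.Adj (e i) (e j) from hij)]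
        norm_num
    have h2 : (Finset.univ : Finset (Fin m)).card = (Finset.univ : Finset V).card := by
      rw [Finset.card_univ, Finset.card_univ, Fintype.card_congr e]
    unfold PP at hp
    rw [h2] at hp
    linarith
  exact ⟨(⟨e, fun {a b} => ⟨key a b, hom a b⟩⟩ : H ≃g G).symm⟩

lemma pp_ge {V : Type} [Fintype V] {G : SimpleGraph V} (h : SmallestCex G) (S : Finset V)
    (hS : S.Nonempty) (hne : S ≠ Finset.univ) : 4 ≤ PP G S := by
  classical
  exact pot_ge_four h _ S le_rfl hne hS

lemma pp_univ {V : Type} [Fintype V] {G : SimpleGraph V} (h : SmallestCex G) :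
    2 ≤ PP G Finset.univ := by
  rw [← pot_eq]
  exact h.2.2.2.2.1

lemma pp_ge_two {V : Type} [Fintype V] {G : SimpleGraph V} (h : SmallestCex G) (S : Finset V)
    (hS : S.Nonempty) : 2 ≤ PP G S := by
  by_cases hne : S = Finset.univ
  · rw [hne]
    exact pp_univ h
  · linarith [pp_ge h S hS hne]

lemma noTri {V : Type} [Fintype V] {G : SimpleGraph V} (h : SmallestCex G) (a b c : V)
    (hab : G.Adj a b) (hbc : G.Adj b c) (hac : G.Adj a c) : False := by
  classical
  by_cases hu : ({a, b, c} : Finset V) = Finset.univ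
  · have := isoOf (G := G) (cycleGraph 3) ![a, b, c] ?_ ?_ ?_
    · obtain ⟨e⟩ := this
      exact h.2.1.false e
    · constructor
      · intro i j
        fin_cases i <;> fin_cases j <;>
          simp [hab.ne, hbc.ne, hac.ne, hab.ne.symm, hbc.ne.symm, hac.ne.symm]
      · intro v
        have : v ∈ ({a, b, c} : Finset V) := by rw [hu]; simp
        simp only [Finset.mem_insert, Finset.mem_singleton] at this
        rcases this with rfl | rfl | rfl
        · exact ⟨0, rfl⟩
        · exact ⟨1, rfl⟩
        · exact ⟨2, rfl⟩
    · intro i j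
      fin_cases i <;> fin_cases j <;> 
        simp [hab, hbc, hac, hab.symm, hbc.symm, hac.symm]
    · rw [C3_pot]
      linarith [pp_univ h]
  · obtain ⟨f, hf⟩ := col_of_ne h.1 _ hu
    have h1 := hf a (by simp) b (by simp) hab
    have h2 := hf b (by simp) c (by simp) hbc
    have h3 := hf a (by simp) c (by simp) hac
    revert h1 h2 h3
    generalize f a = x
    generalize f b = y
    generalize f c = z
    revert x y z
    decide

/-- `x` parametrizes a 5-cycle of `G` -/
structure Cell {V : Type} (G : SimpleGraph V) (x : Fin 5 → V) : Prop where
  inj : Function.Injective x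
  adj : ∀ i, G.Adj (x i) (x (i + 1))

def Out {V : Type} (G : SimpleGraph V) (x : Fin 5 → V) (i : Fin 5) (y : V) : Prop :=
  G.Adj (x i) y ∧ ∀ j, x j ≠ y

lemma Cell.rot {V : Type} {G : SimpleGraph V} {x : Fin 5 → V} (hx : Cell G x) (k : Fin 5) :
    Cell G (fun i => x (k + i)) :=
  ⟨fun i j hij => add_left_cancel (hx.inj hij), fun i => by
    have := hx.adj (k + i)
    rwa [add_assoc] at this⟩

lemma Cell.refl {V : Type} {G : SimpleGraph V} {x : Fin 5 → V} (hx : Cell G x) :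
    Cell G (fun i => x (- i)) :=
  ⟨fun i j hij => neg_injective (hx.inj hij), fun i => by
    have := hx.adj (- (i + 1))
    rw [show -(i + 1) + 1 = -i by clear this; revert i; decide] at this
    exact this.symm⟩

lemma Cell.adj' {V : Type} {G : SimpleGraph V} {x : Fin 5 → V} (hx : Cell G x) (i j : Fin 5)
    (h : A5 i j) : G.Adj (x i) (x j) := by
  rcases h with h | h
  · have := hx.adj j
    rw [show j + 1 = i by clear this; revert i j; decide] at this
    exact this.symm
  · have := hx.adj i
    rwa [show i + 1 = j by clear this; revert i j; decide] at this

lemma Cell.chord {V : Type} [Fintype V] {G : SimpleGraph V} (h : SmallestCex G) {x : Fin 5 → V}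
    (hx : Cell G x) (i j : Fin 5) (hij : G.Adj (x i) (x j)) : A5 i j := by
  by_contra hn
  have hne : i ≠ j := fun he => hij.ne (by rw [he])
  have : ∀ i j : Fin 5, i ≠ j → ¬ A5 i j → ∃ k, A5 i k ∧ A5 k j := by decide
  obtain ⟨k, h1, h2⟩ := this i j hne hn
  exact noTri h _ _ _ (hx.adj' _ _ h1) (hx.adj' _ _ h2) hij

lemma KExt {V : Type} [Fintype V] {G : SimpleGraph V} (h : SmallestCex G) {x : Fin 5 → V}
    (hx : Cell G x) (T : Finset V) (hT : ∀ v, (∀ i, x i ≠ v) → v ∈ T) (f : V → Fin 5)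
    (hf : IsCol G T f) (s e : Fin 5) (he : e = 1 ∨ e = 4)
    (hs : ∀ i y, Out G x i y → A5 (s + i * e) (f y)) : False := by
  classical
  let g : V → Fin 5 := fun v => if hv : ∃ i, x i = v then s + hv.choose * e else f v
  have g1 : ∀ i, g (x i) = s + i * e := by
    intro i
    have hex : ∃ j, x j = x i := ⟨i, rfl⟩
    have : hex.choose = i := hx.inj hex.choose_spec
    simp only [g, hex, dif_pos, this]
  have g2 : ∀ v, (∀ i, x i ≠ v) → g v = f v := by
    intro v hv
    have : ¬ ∃ i, x i = v := by push Not; exact hv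
    simp only [g, this, dif_neg, not_false_eq_true]
  apply noCol_univ h.1.1 g
  intro u _ v _ huv
  by_cases hu : ∃ i, x i = u
  · obtain ⟨i, rfl⟩ := hu
    by_cases hv : ∃ i, x i = v
    · obtain ⟨j, rfl⟩ := hv
      rw [g1, g1]
      have hij := hx.chord h i j huv
      revert hij he
      clear * -
      revert s e i j
      decide +kernel
    · push Not at hv
      rw [g1, g2 v hv]
      exact hs i v ⟨huv, hv⟩
  · push Not at hu
    by_cases hv : ∃ i, x i = v
    · obtain ⟨j, rfl⟩ := hv
      rw [g1, g2 u hu]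
      exact A5_symm (hs j u ⟨huv.symm, hu⟩)
    · push Not at hv
      rw [g2 u hu, g2 v hv]
      exact hf u (hT u hu) v (hT v hv) huv

lemma fin5_cases (i : Fin 5) : i = 0 ∨ i = 1 ∨ i = 2 ∨ i = 3 ∨ i = 4 := by
  revert i
  decide

open Classical in
lemma caseD {V : Type} [Fintype V] {G : SimpleGraph V} (h : SmallestCex G) {x : Fin 5 → V}
    (hx : Cell G x) (h2 : ∀ y, ¬ Out G x 2 y) (h3 : ∀ y, ¬ Out G x 3 y)
    (h4 : ∀ y, ¬ Out G x 4 y) : False := by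
  have hm : ∀ v, v ∈ ({x 2, x 3, x 4} : Finset V)ᶜ ↔ v ≠ x 2 ∧ v ≠ x 3 ∧ v ≠ x 4 := by
    intro v; simp
  obtain ⟨f, hf⟩ := col_of_ne h.1 (({x 2, x 3, x 4} : Finset V)ᶜ) (by
    intro he
    have : x 2 ∈ ({x 2, x 3, x 4} : Finset V)ᶜ := by rw [he]; simp
    simp at this)
  have m0 : x 0 ∈ ({x 2, x 3, x 4} : Finset V)ᶜ := by
    rw [hm]; simp [hx.inj.eq_iff]
  have m1 : x 1 ∈ ({x 2, x 3, x 4} : Finset V)ᶜ := by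
    rw [hm]; simp [hx.inj.eq_iff]
  have mo : ∀ v, (∀ i, x i ≠ v) → v ∈ ({x 2, x 3, x 4} : Finset V)ᶜ := by
    intro v hv
    rw [hm]
    exact ⟨(hv _).symm, (hv _).symm, (hv _).symm⟩
  have c01 := hf _ m0 _ m1 (hx.adj 0)
  refine KExt h hx _ mo f hf (f (x 0)) (f (x 1) - f (x 0)) ?_ ?_
  · revert c01
    generalize f (x 0) = a
    generalize f (x 1) = b
    revert a b
    decide
  · intro i y hy
    rcases fin5_cases i with rfl | rfl | rfl | rfl | rfl
    · simpa using hf _ m0 _ (mo y hy.2) hy.1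
    · simpa using hf _ m1 _ (mo y hy.2) hy.1
    · exact absurd hy (h2 y)
    · exact absurd hy (h3 y)
    · exact absurd hy (h4 y)

open Classical in
lemma caseC {V : Type} [Fintype V] {G : SimpleGraph V} (h : SmallestCex G) {x : Fin 5 → V}
    (hx : Cell G x) (h1 : ∀ y, ¬ Out G x 1 y) (h3 : ∀ y, ¬ Out G x 3 y)
    (h4 : ∀ y, ¬ Out G x 4 y) (y2 : V) (hy2 : Out G x 2 y2) (hu : ∀ y, Out G x 2 y → y = y2) :
    False := by
  have hm : ∀ v, v ∈ ({x 3, x 4} : Finset V)ᶜ ↔ v ≠ x 3 ∧ v ≠ x 4 := by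
    intro v; simp
  obtain ⟨f, hf⟩ := col_of_ne h.1 (({x 3, x 4} : Finset V)ᶜ) (by
    intro he
    have : x 3 ∈ ({x 3, x 4} : Finset V)ᶜ := by rw [he]; simp
    simp at this)
  have m0 : x 0 ∈ ({x 3, x 4} : Finset V)ᶜ := by
    rw [hm]; simp [hx.inj.eq_iff]
  have m1 : x 1 ∈ ({x 3, x 4} : Finset V)ᶜ := by
    rw [hm]; simp [hx.inj.eq_iff]
  have m2 : x 2 ∈ ({x 3, x 4} : Finset V)ᶜ := by
    rw [hm]; simp [hx.inj.eq_iff]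
  have mo : ∀ v, (∀ i, x i ≠ v) → v ∈ ({x 3, x 4} : Finset V)ᶜ := by
    intro v hv
    rw [hm]
    exact ⟨(hv _).symm, (hv _).symm⟩
  have c01 := hf _ m0 _ m1 (hx.adj 0)
  have c12 := hf _ m1 _ m2 (hx.adj 1)
  have c2y := hf _ m2 _ (mo _ hy2.2) hy2.1
  have key : ∃ e : Fin 5, (e = 1 ∨ e = 4) ∧ A5 (f (x 0) + 2 * e) (f y2) := by
    revert c01 c12 c2y
    generalize f (x 0) = a
    generalize f (x 1) = b
    generalize f (x 2) = c
    generalize f y2 = d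
    revert a b c d
    decide +kernel
  obtain ⟨e, he, hey⟩ := key
  refine KExt h hx _ mo f hf (f (x 0)) e he ?_
  · intro i y hy
    rcases fin5_cases i with rfl | rfl | rfl | rfl | rfl
    · simpa using hf _ m0 _ (mo y hy.2) hy.1
    · exact absurd hy (h1 y)
    · rw [hu y hy]
      exact hey
    · exact absurd hy (h3 y)
    · exact absurd hy (h4 y)

open Classical in
lemma addEdge {V : Type} [Fintype V] {G : SimpleGraph V} (h : SmallestCex G) (D : Finset V)
    (hD : D.Nonempty) (y0 y1 : V) (hy : y0 ≠ y1) (m0 : y0 ∉ D) (m1 : y1 ∉ D)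
    (hno : ∀ f, IsCol G Dᶜ f → A5 (f y0) (f y1) → False) :
    ∃ X : Finset V, X ⊆ Dᶜ ∧ y0 ∈ X ∧ y1 ∈ X ∧ (PP G X ≤ 6 ∨ (PP G X ≤ 7 ∧
      ∃ z, X = {y0, y1, z} ∧ G.Adj z y0 ∧ G.Adj z y1)) := by
  obtain ⟨Gs, hGs⟩ : ∃ Gs : SimpleGraph V, ∀ a b, Gs.Adj a b ↔
      (G.Adj a b ∨ (a = y0 ∧ b = y1) ∨ (a = y1 ∧ b = y0)) := 
    ⟨{ Adj := fun a b => (G.Adj a b ∨ (a = y0 ∧ b = y1) ∨ (a = y1 ∧ b = y0))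
       symm := ⟨fun a b hab => by
        rcases hab with hab | hab | hab
        · exact Or.inl hab.symm
        · exact Or.inr (Or.inr ⟨hab.2, hab.1⟩)
        · exact Or.inr (Or.inl ⟨hab.2, hab.1⟩)⟩
       loopless := ⟨fun a hab => by
        rcases hab with hab | hab | hab
        · exact hab.ne rfl
        · exact hy (hab.1.symm.trans hab.2)
        · exact hy (hab.2.symm.trans hab.1)⟩ }, fun _ _ => Iff.rfl⟩
  obtain ⟨d, hd⟩ := hD
  obtain ⟨X, hXR, hXno, hX⟩ := red h Gs Dᶜ (by
    intro he
    have : d ∈ Dᶜ := by rw [he]; simp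
    simp [hd] at this) (by
    intro f hf
    apply hno f
    · intro u hu v hv huv
      exact hf u hu v hv ((hGs _ _).2 (Or.inl huv))
    · exact hf _ (by simpa using m0) _ (by simpa using m1) ((hGs _ _).2 (Or.inr (Or.inl ⟨rfl, rfl⟩))))
  have hXu : X ≠ Finset.univ := by
    intro he
    have := hXR (show d ∈ X by rw [he]; simp)
    simp [hd] at this
  have hboth : y0 ∈ X ∧ y1 ∈ X := by
    by_contra hcon
    obtain ⟨f, hf⟩ := col_of_ne h.1 X hXu
    apply hXno f
    intro u hu v hv huv
    rcases (hGs _ _).1 huv with h1 | ⟨rfl, rfl⟩ | ⟨rfl, rfl⟩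
    · exact hf u hu v hv h1
    · exact absurd ⟨hu, hv⟩ hcon
    · exact absurd ⟨hv, hu⟩ hcon
  have hPP : PP G X ≤ PP Gs X + 4 := by
    have : ee Gs X X ≤ ee G X X + ((∑ a ∈ X, ∑ b ∈ X, if a = y0 then if b = y1 then 1 else 0 else 0) +
      (∑ a ∈ X, ∑ b ∈ X, if a = y1 then if b = y0 then 1 else 0 else 0)) := by
      unfold ee
      rw [← Finset.sum_add_distrib, ← Finset.sum_add_distrib]
      apply Finset.sum_le_sum
      intro a _
      rw [← Finset.sum_add_distrib, ← Finset.sum_add_distrib]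
      apply Finset.sum_le_sum
      intro b _
      rw [hGs]
      split_ifs <;> simp_all
    have e1 : ∀ p q : V, p ∈ X → q ∈ X →
        (∑ a ∈ X, ∑ b ∈ X, if a = p then if b = q then (1 : ℤ) else 0 else 0) = 1 := by
      intro p q hp hq
      rw [Finset.sum_eq_single p]
      · simp [hq]
      · intro b _ hb
        simp [hb]
      · intro hh
        exact absurd hp hh
    rw [e1 _ _ hboth.1 hboth.2, e1 _ _ hboth.2 hboth.1] at this
    unfold PP
    linarith
  refine ⟨X, hXR, hboth.1, hboth.2, ?_⟩
  rcases hX with hX | ⟨hX, a, b, c, habc, hab, hbc, hac⟩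
  · left
    linarith
  right
  refine ⟨by linarith, ?_⟩
  have hX' : X = {a, b, c} := by
    apply Finset.coe_injective
    rw [habc]
    simp
  have key : ∀ z, z ≠ y0 → z ≠ y1 → X = {y0, y1, z} → Gs.Adj z y0 → Gs.Adj z y1 → 
      ∃ z, X = {y0, y1, z} ∧ G.Adj z y0 ∧ G.Adj z y1 := by
    intro z hz0 hz1 hXz ha hb
    rw [hGs] at ha hb
    refine ⟨z, hXz, ?_, ?_⟩
    · rcases ha with ha | ha | ha
      · exact ha
      · exact absurd ha.1 hz0
      · exact absurd ha.1 hz1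
    · rcases hb with hb | hb | hb
      · exact hb
      · exact absurd hb.1 hz0
      · exact absurd hb.1 hz1
  have b0 := hboth.1
  have b1 := hboth.2
  rw [hX'] at b0 b1
  simp only [Finset.mem_insert, Finset.mem_singleton] at b0 b1
  rcases b0 with rfl | rfl | rfl <;> rcases b1 with rfl | rfl | rfl
  · exact absurd rfl hy
  · exact key c hac.ne.symm hbc.ne.symm hX' hac.symm hbc.symm
  · exact key b hab.ne.symm hbc.ne (by rw [hX', Finset.pair_comm]) hab.symm hbc
  · exact key c hbc.ne.symm hac.ne.symm (by rw [hX', Finset.insert_comm]) hbc.symm hac.symm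
  · exact absurd rfl hy
  · exact key a hab.ne hac.ne (by rw [hX', Finset.insert_comm, Finset.pair_comm a]) hab hac
  · exact key b hbc.ne hab.ne.symm (by rw [hX', Finset.pair_comm b, Finset.insert_comm]) hbc hab.symm
  · exact key a hac.ne hab.ne (by rw [hX', Finset.pair_comm y1, Finset.insert_comm, Finset.pair_comm a]) hac hab
  · exact absurd rfl hy

lemma c5_form : ∀ a b c d e : Fin 5, A5 a b → A5 b c → A5 c d → A5 d e → A5 e a →
    c = 2 * b - a ∧ d = 3 * b - 2 * a ∧ e = 4 * b - 3 * a := by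
  decide +kernel

lemma c5_inj : ∀ a b : Fin 5, A5 a b →
    a ≠ 2 * b - a ∧ b ≠ 2 * b - a ∧ a ≠ 3 * b - 2 * a ∧ b ≠ 3 * b - 2 * a ∧
    2 * b - a ≠ 3 * b - 2 * a ∧ 2 * b - a ≠ 4 * b - 3 * a ∧ 3 * b - 2 * a ≠ 4 * b - 3 * a := by
  decide +kernel

open Classical in
lemma ins1 {V : Type} (G : SimpleGraph V) (A : Finset V) (v t : V) (hv : v ∉ A)
    (ht : t ∈ A) (hvt : G.Adj v t) : PP G (insert v A) ≤ PP G A + 1 := by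
  have := PP_insert G A v hv {t} (by simp [ht, hvt])
  simp at this
  linarith

open Classical in
lemma ins2 {V : Type} (G : SimpleGraph V) (A : Finset V) (v t t' : V) (hv : v ∉ A)
    (ht : t ∈ A) (hvt : G.Adj v t) (ht' : t' ∈ A) (hvt' : G.Adj v t') (hne : t ≠ t') :
    PP G (insert v A) ≤ PP G A - 3 := by
  have := PP_insert G A v hv {t, t'} (by simp [ht, hvt, ht', hvt'])
  rw [Finset.card_pair hne] at this
  push_cast at this
  linarith

open Classical in
lemma ins3 {V : Type} (G : SimpleGraph V) (A : Finset V) (v t t' t'' : V) (hv : v ∉ A)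
    (ht : t ∈ A) (hvt : G.Adj v t) (ht' : t' ∈ A) (hvt' : G.Adj v t')
    (ht'' : t'' ∈ A) (hvt'' : G.Adj v t'') (h1 : t ≠ t') (h2 : t ≠ t'') (h3 : t' ≠ t'') :
    PP G (insert v A) ≤ PP G A - 7 := by
  have := PP_insert G A v hv {t, t', t''} (by simp [ht, hvt, ht', hvt', ht'', hvt''])
  rw [Finset.card_eq_three.2 ⟨t, t', t'', h1, h2, h3, rfl⟩] at this
  push_cast at this
  linarith

open Classical in
lemma core {V : Type} [Fintype V] {G : SimpleGraph V} (h : SmallestCex G) {x : Fin 5 → V}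
    (hx : Cell G x) (y0 y1 y : V) (h0 : Out G x 0 y0) (h1 : Out G x 1 y1) (t : Fin 5)
    (ht : t = 2 ∨ t = 3) (hty : Out G x t y) (X : Finset V) (hXK : ∀ i, x i ∉ X)
    (m0 : y0 ∈ X) (m1 : y1 ∈ X) (hX : PP G X ≤ 6 ∨ (PP G X ≤ 7 ∧
      ∃ z, X = {y0, y1, z} ∧ G.Adj z y0 ∧ G.Adj z y1)) :
    ∃ z b, (∀ i, x i ≠ z) ∧ G.Adj z y0 ∧ G.Adj z y1 ∧ y ≠ y0 ∧ y ≠ y1 ∧ y ≠ z ∧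
      b ≠ y0 ∧ b ≠ y1 ∧ b ≠ z ∧ (∀ i, x i ≠ b) ∧ G.Adj y b ∧
      (∀ v, (∃ i, v = x i) ∨ v = y0 ∨ v = y1 ∨ v = z ∨ v = y ∨ v = b) ∧
      (t = 2 → G.Adj b y1) ∧ (t = 3 → G.Adj b z) := by
  have ne : ∀ i j, i ≠ j → x i ≠ x j := fun i j hij he => hij (hx.inj he)
  have hmem : ∀ v, v ∈ insert (x 1) (insert (x 2) (insert (x 3) (insert (x 4) (insert (x 0) X)))) ↔
      (∃ i, v = x i) ∨ v ∈ X := by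
    intro v
    simp only [Finset.mem_insert]
    constructor
    · rintro (hh | hh | hh | hh | hh | hh)
      all_goals first | exact Or.inl ⟨_, hh⟩ | exact Or.inr hh
    · rintro (⟨i, rfl⟩ | hh)
      · rcases fin5_cases i with rfl | rfl | rfl | rfl | rfl <;> simp
      · simp [hh]
  -- insertion sequence
  have n0 : x 0 ∉ X := hXK 0
  have n4 : x 4 ∉ insert (x 0) X := by simp [hXK, hx.inj.eq_iff]
  have n3 : x 3 ∉ insert (x 4) (insert (x 0) X) := by simp [hXK, hx.inj.eq_iff]
  have n2 : x 2 ∉ insert (x 3) (insert (x 4) (insert (x 0) X)) := by simp [hXK, hx.inj.eq_iff]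
  have n1 : x 1 ∉ insert (x 2) (insert (x 3) (insert (x 4) (insert (x 0) X))) := by
    simp [hXK, hx.inj.eq_iff]
  have i0 := ins1 G _ (x 0) y0 n0 m0 h0.1
  have i4 := ins1 G _ (x 4) (x 0) n4 (by simp) (hx.adj 4)
  have i3 := ins1 G _ (x 3) (x 4) n3 (by simp) (hx.adj 3)
  have i2 := ins1 G _ (x 2) (x 3) n2 (by simp) (hx.adj 2)
  have i1 := ins3 G _ (x 1) (x 0) (x 2) y1 n1 (by simp) (hx.adj 0).symm (by simp) (hx.adj 1)
    (by simp [m1]) h1.1 (ne _ _ (by decide)) (h1.2 _) (h1.2 _)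
  have hyX : y ∉ X := by
    intro hyX
    have h2 := pp_ge_two h (insert (x 1) (insert (x 2) (insert (x 3) (insert (x 4) (insert (x 0) X)))))
      (by simp)
    have hX7 : PP G X ≤ 7 := by
      rcases hX with hX | hX
      · linarith
      · exact hX.1
    rcases ht with rfl | rfl
    · have i2' := ins2 G _ (x 2) (x 3) y n2 (by simp) (hx.adj 2) (by simp [hyX]) hty.1 (hty.2 _)
      linarith
    · have i3' := ins2 G _ (x 3) (x 4) y n3 (by simp) (hx.adj 3) (by simp [hyX]) hty.1 (hty.2 _)
      linarith
  generalize hS : insert (x 1) (insert (x 2) (insert (x 3) (insert (x 4) (insert (x 0) X)))) = S at *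
  have hyS : y ∉ S := by
    rw [hmem]
    rintro (⟨i, hi⟩ | hh)
    · exact hty.2 i hi.symm
    · exact hyX hh
  have hSu : S ≠ Finset.univ := fun he => hyS (he ▸ Finset.mem_univ y)
  have hSne : S.Nonempty := ⟨x 0, (hmem _).2 (Or.inl ⟨0, rfl⟩)⟩
  have hS4 := pp_ge h S hSne hSu
  rcases hX with hX | ⟨hX, z, hXz, hz0, hz1⟩
  · linarith
  have hmX : ∀ v, v ∈ X ↔ v = y0 ∨ v = y1 ∨ v = z := by
    intro v
    simp [hXz]
  have hzX : z ∈ X := by simp [hmX]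
  have hzK : ∀ i, x i ≠ z := fun i hi => hXK i (hi ▸ hzX)
  obtain ⟨f, hf⟩ := col_of_ne h.1 S hSu
  have mx : ∀ i, x i ∈ S := fun i => (hmem _).2 (Or.inl ⟨i, rfl⟩)
  have my0 : y0 ∈ S := (hmem _).2 (Or.inr m0)
  have my1 : y1 ∈ S := (hmem _).2 (Or.inr m1)
  have mz : z ∈ S := (hmem _).2 (Or.inr hzX)
  have c01 := hf _ (mx 0) _ (mx 1) (hx.adj 0)
  have f1 := c5_form _ _ _ _ _ c01 (hf _ (mx 1) _ (mx 2) (hx.adj 1))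
    (hf _ (mx 2) _ (mx 3) (hx.adj 2)) (hf _ (mx 3) _ (mx 4) (hx.adj 3))
    (hf _ (mx 4) _ (mx 0) (hx.adj 4))
  have f2 := c5_form _ _ _ _ _ c01 (hf _ (mx 1) _ my1 h1.1) (hf _ my1 _ mz hz1.symm)
    (hf _ mz _ my0 hz0) (hf _ my0 _ (mx 0) h0.1.symm)
  have fi := c5_inj _ _ c01
  rw [← f1.1, ← f1.2.1, ← f1.2.2] at fi
  have fy1 : f y1 = f (x 2) := f2.1.trans f1.1.symm
  have fz : f z = f (x 3) := f2.2.1.trans f1.2.1.symm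
  have fy0 : f y0 = f (x 4) := f2.2.2.trans f1.2.2.symm
  obtain ⟨a, b, w, w', ha, hb, hw, hw', hcov, hab, haw, hbw, hff, hua, hub⟩ :=
    pot_four h S hSu hSne f hf (fun hinj => h1.2 2 (hinj (mx 2) my1 fy1.symm)) (by linarith)
  have last : ∀ b w', b ∉ S → w' ∈ S → (∀ v, v ∈ S ∨ v = y ∨ v = b) → G.Adj y b →
      G.Adj b w' → f w' = f (x t) → 
      ∃ z b, (∀ i, x i ≠ z) ∧ G.Adj z y0 ∧ G.Adj z y1 ∧ y ≠ y0 ∧ y ≠ y1 ∧ y ≠ z ∧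
      b ≠ y0 ∧ b ≠ y1 ∧ b ≠ z ∧ (∀ i, x i ≠ b) ∧ G.Adj y b ∧
      (∀ v, (∃ i, v = x i) ∨ v = y0 ∨ v = y1 ∨ v = z ∨ v = y ∨ v = b) ∧
      (t = 2 → G.Adj b y1) ∧ (t = 3 → G.Adj b z) := by
    intro b w' hb hw' hcov hyb hbw hfw
    have hnw : w' ≠ x t := by
      rintro rfl
      exact noTri h _ _ _ hyb hbw hty.1.symm
    refine ⟨z, b, hzK, hz0, hz1, fun he => hyS (he ▸ my0), fun he => hyS (he ▸ my1),
      fun he => hyS (he ▸ mz), fun he => hb (he ▸ my0), fun he => hb (he ▸ my1),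
      fun he => hb (he ▸ mz), fun i he => hb (he ▸ mx i), hyb, ?_, ?_, ?_⟩
    · intro v
      rcases hcov v with hv | hv | hv
      · rcases (hmem v).1 hv with hv | hv
        · exact Or.inl hv
        · rcases (hmX v).1 hv with hv | hv | hv <;> simp [hv]
      · simp [hv]
      · simp [hv]
    · rintro rfl
      suffices w' = y1 by rwa [← this]
      rcases (hmem w').1 hw' with ⟨i, rfl⟩ | hv
      · exfalso
        rcases fin5_cases i with rfl | rfl | rfl | rfl | rfl
        · exact fi.1 hfw
        · exact fi.2.1 hfw
        · exact hnw rfl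
        · exact fi.2.2.2.2.1 hfw.symm
        · exact fi.2.2.2.2.2.1 hfw.symm
      · rcases (hmX w').1 hv with rfl | rfl | rfl
        · rw [fy0] at hfw
          exact absurd hfw.symm fi.2.2.2.2.2.1
        · rfl
        · rw [fz] at hfw
          exact absurd hfw.symm fi.2.2.2.2.1
    · rintro rfl
      suffices w' = z by rwa [← this]
      rcases (hmem w').1 hw' with ⟨i, rfl⟩ | hv
      · exfalso
        rcases fin5_cases i with rfl | rfl | rfl | rfl | rfl
        · exact fi.2.2.1 hfw
        · exact fi.2.2.2.1 hfw
        · exact fi.2.2.2.2.1 hfw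
        · exact hnw rfl
        · exact fi.2.2.2.2.2.2 hfw.symm
      · rcases (hmX w').1 hv with rfl | rfl | rfl
        · rw [fy0] at hfw
          exact absurd hfw.symm fi.2.2.2.2.2.2
        · rw [fy1] at hfw
          exact absurd hfw fi.2.2.2.2.1
        · rfl
  rcases hcov y with hh | rfl | rfl
  · exact absurd hh hyS
  · have := hua (x t) (mx t) hty.1.symm
    exact last b w' hb hw' hcov hab hbw (by rw [← hff, this])
  · have := hub (x t) (mx t) hty.1.symm
    exact last a w ha hw (fun v => by rcases hcov v with hv | hv | hv <;> simp [hv]) hab.symm haw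
      (by rw [hff, this])

lemma adjSymm {V : Type} {G : SimpleGraph V} {m : ℕ} (E : SimpleGraph (Fin m))
    (r : Fin m → Fin m → Prop) (hE : ∀ a b, E.Adj a b ↔ (r a b ∨ r b a)) (g : Fin m → V)
    (hr : ∀ a b, r a b → G.Adj (g a) (g b)) : ∀ i j, E.Adj i j → G.Adj (g i) (g j) := by
  intro i j hij
  rcases (hE i j).1 hij with hh | hh
  · exact hr _ _ hh
  · exact (hr _ _ hh).symm

open Classical in
lemma caseB {V : Type} [Fintype V] {G : SimpleGraph V} (h : SmallestCex G) {x : Fin 5 → V}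
    (hx : Cell G x) (h2 : ∀ y, ¬ Out G x 2 y) (h4 : ∀ y, ¬ Out G x 4 y)
    (y0 y1 y3 : V) (h0 : Out G x 0 y0) (h1 : Out G x 1 y1) (h3 : Out G x 3 y3)
    (hu0 : ∀ y, Out G x 0 y → y = y0) (hu1 : ∀ y, Out G x 1 y → y = y1)
    (hu3 : ∀ y, Out G x 3 y → y = y3) : False := by
  have hy : y0 ≠ y1 := by
    rintro rfl
    exact noTri h _ _ _ (hx.adj 0) h1.1 h0.1
  have mo : ∀ v, (∀ i, x i ≠ v) → v ∈ (Finset.univ.image x)ᶜ := by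
    intro v hv
    simpa using hv
  obtain ⟨X, hXD, m0, m1, hX⟩ := addEdge h (Finset.univ.image x) (by simp) y0 y1 hy
    (by simpa using h0.2) (by simpa using h1.2) (by
      intro f hf hc
      have key : ∃ s e : Fin 5, (e = 1 ∨ e = 4) ∧ A5 (s + 0 * e) (f y0) ∧ A5 (s + 1 * e) (f y1) ∧
          A5 (s + 3 * e) (f y3) := by
        revert hc
        generalize f y0 = a
        generalize f y1 = b
        generalize f y3 = c
        revert a b c
        decide +kernel
      obtain ⟨s, e, he, k0, k1, k3⟩ := key
      refine KExt h hx _ mo f hf s e he ?_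
      intro i y hy
      rcases fin5_cases i with rfl | rfl | rfl | rfl | rfl
      · rw [hu0 y hy]; exact k0
      · rw [hu1 y hy]; exact k1
      · exact absurd hy (h2 y)
      · rw [hu3 y hy]; exact k3
      · exact absurd hy (h4 y))
  obtain ⟨z, b, hzK, hz0, hz1, a0, a1, a2, b0, b1, b2, hbK, hyb, hcov, -, hbz⟩ :=
    core h hx y0 y1 y3 h0 h1 3 (Or.inr rfl) h3 X (by
      intro i hi
      have := hXD hi
      simp at this) m0 m1 hX
  have hbz := hbz rfl
  have := isoOf (G := G) E2 ![x 0, x 1, x 2, x 3, x 4, y1, z, y0, y3, b] ?_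
    (adjSymm E2 E2r E2_adj _ ?_) ?_
  · obtain ⟨e⟩ := this
    exact h.2.2.2.1.false e
  · have hy' := hy.symm
    have z0 := hz0.ne
    have z1 := hz1.ne
    have z0' := hz0.ne.symm
    have z1' := hz1.ne.symm
    have k0 := h0.2
    have k1 := h1.2
    have k3 := h3.2
    have k0' := fun i => (h0.2 i).symm
    have k1' := fun i => (h1.2 i).symm
    have k3' := fun i => (h3.2 i).symm
    have hzK' := fun i => (hzK i).symm
    have hbK' := fun i => (hbK i).symm
    constructor
    · intro i j
      fin_cases i <;> fin_cases j <;>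
        simp [hx.inj.eq_iff, hy, hy', z0, z1, z0', z1', k0, k1, k3, k0', k1', k3', hzK, hzK', hbK, hbK', a0, a1, a2, a0.symm, a1.symm, a2.symm, b0, b1, b2, b0.symm, b1.symm, b2.symm, hyb.ne, hyb.ne.symm]
    · intro v
      rcases hcov v with ⟨i, rfl⟩ | rfl | rfl | rfl | rfl | rfl
      · rcases fin5_cases i with rfl | rfl | rfl | rfl | rfl
        · exact ⟨0, rfl⟩
        · exact ⟨1, rfl⟩
        · exact ⟨2, rfl⟩
        · exact ⟨3, rfl⟩
        · exact ⟨4, rfl⟩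
      · exact ⟨7, rfl⟩
      · exact ⟨5, rfl⟩
      · exact ⟨6, rfl⟩
      · exact ⟨8, rfl⟩
      · exact ⟨9, rfl⟩
  · intro i j hij
    unfold E2r at hij
    rcases hij with ⟨rfl, rfl⟩ | ⟨rfl, rfl⟩ | ⟨rfl, rfl⟩ | ⟨rfl, rfl⟩ | ⟨rfl, rfl⟩ | ⟨rfl, rfl⟩ |
      ⟨rfl, rfl⟩ | ⟨rfl, rfl⟩ | ⟨rfl, rfl⟩ | ⟨rfl, rfl⟩ | ⟨rfl, rfl⟩ | ⟨rfl, rfl⟩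
    · exact hx.adj 0
    · exact hx.adj 1
    · exact hx.adj 2
    · exact hx.adj 3
    · exact hx.adj 4
    · exact h1.1
    · exact hz1.symm
    · exact hz0
    · exact h0.1.symm
    · exact h3.1
    · exact hyb
    · exact hbz
  · rw [E2_pot]
    linarith [pp_univ h]

open Classical in
lemma caseA {V : Type} [Fintype V] {G : SimpleGraph V} (h : SmallestCex G) {x : Fin 5 → V}
    (hx : Cell G x) (h3 : ∀ y, ¬ Out G x 3 y) (h4 : ∀ y, ¬ Out G x 4 y)
    (y0 y1 y2 : V) (h0 : Out G x 0 y0) (h1 : Out G x 1 y1) (h2 : Out G x 2 y2)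
    (hu0 : ∀ y, Out G x 0 y → y = y0) (hu1 : ∀ y, Out G x 1 y → y = y1)
    (hu2 : ∀ y, Out G x 2 y → y = y2) : False := by
  have ne : ∀ i j, i ≠ j → x i ≠ x j := fun i j hij he => hij (hx.inj he)
  have hy : y0 ≠ y1 := by
    rintro rfl
    exact noTri h _ _ _ (hx.adj 0) h1.1 h0.1
  have hm : ∀ v, v ∈ ({x 0, x 3, x 4} : Finset V)ᶜ ↔ v ≠ x 0 ∧ v ≠ x 3 ∧ v ≠ x 4 := by
    intro v; simp
  have mo : ∀ v, (∀ i, x i ≠ v) → v ∈ ({x 0, x 3, x 4} : Finset V)ᶜ := by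
    intro v hv
    rw [hm]
    exact ⟨(hv _).symm, (hv _).symm, (hv _).symm⟩
  have mx1 : x 1 ∈ ({x 0, x 3, x 4} : Finset V)ᶜ := by
    rw [hm]; simp [hx.inj.eq_iff]
  have mx2 : x 2 ∈ ({x 0, x 3, x 4} : Finset V)ᶜ := by
    rw [hm]; simp [hx.inj.eq_iff]
  obtain ⟨X, hXD, m0, m1, hX⟩ := addEdge h {x 0, x 3, x 4} (by simp) y0 y1 hy
    (Finset.mem_compl.1 (mo _ h0.2)) (Finset.mem_compl.1 (mo _ h1.2)) (by
      intro f hf hc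
      have c1 := hf _ (mo _ h1.2) _ mx1 h1.1.symm
      have c2 := hf _ mx1 _ mx2 (hx.adj 1)
      have c3 := hf _ mx2 _ (mo _ h2.2) h2.1
      have hne : f y1 ≠ f y2 := by
        revert c1 c2 c3
        generalize f y1 = a
        generalize f (x 1) = b
        generalize f (x 2) = c
        generalize f y2 = d
        revert a b c d
        decide +kernel
      have key : ∃ s e : Fin 5, (e = 1 ∨ e = 4) ∧ A5 (s + 0 * e) (f y0) ∧ A5 (s + 1 * e) (f y1) ∧
          A5 (s + 2 * e) (f y2) := by
        revert hc hne
        generalize f y0 = a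
        generalize f y1 = b
        generalize f y2 = c
        revert a b c
        decide +kernel
      obtain ⟨s, e, he, k0, k1, k2⟩ := key
      refine KExt h hx _ mo f hf s e he ?_
      intro i y hy
      rcases fin5_cases i with rfl | rfl | rfl | rfl | rfl
      · rw [hu0 y hy]; exact k0
      · rw [hu1 y hy]; exact k1
      · rw [hu2 y hy]; exact k2
      · exact absurd hy (h3 y)
      · exact absurd hy (h4 y))
  have n0 : x 0 ∉ X := fun hh => ((hm _).1 (hXD hh)).1 rfl
  have n3 : x 3 ∉ X := fun hh => ((hm _).1 (hXD hh)).2.1 rfl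
  have n4 : x 4 ∉ X := fun hh => ((hm _).1 (hXD hh)).2.2 rfl
  have n4' : x 4 ∉ insert (x 0) X := by simp [n4, hx.inj.eq_iff]
  have n3' : x 3 ∉ insert (x 4) (insert (x 0) X) := by simp [n3, hx.inj.eq_iff]
  have hX7 : PP G X ≤ 7 := by
    rcases hX with hX | hX
    · linarith
    · exact hX.1
  have i4 := ins1 G _ (x 4) (x 0) n4' (by simp) (hx.adj 4)
  have p1 : x 1 ∉ X := by
    intro p1
    have i0 := ins2 G _ (x 0) y0 (x 1) n0 m0 h0.1 p1 (hx.adj 0) (h0.2 1).symm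
    by_cases p2 : x 2 ∈ X
    · have i3 := ins2 G _ (x 3) (x 4) (x 2) n3' (by simp) (hx.adj 3) (by simp [p2])
        (hx.adj 2).symm (ne _ _ (by decide))
      have g2 := pp_ge_two h _ (Finset.insert_nonempty (x 3) (insert (x 4) (insert (x 0) X)))
      rcases hX with hX | ⟨-, z, hXz, -, -⟩
      · linarith
      · rw [hXz] at p1 p2
        simp only [Finset.mem_insert, Finset.mem_singleton] at p1 p2
        have q1 : x 1 = z := by
          rcases p1 with p | p | p
          · exact absurd p (h0.2 1)
          · exact absurd p (h1.2 1)
          · exact p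
        have q2 : x 2 = z := by
          rcases p2 with p | p | p
          · exact absurd p (h0.2 2)
          · exact absurd p (h1.2 2)
          · exact p
        exact ne 1 2 (by decide) (q1.trans q2.symm)
    · have n2 : x 2 ∉ insert (x 3) (insert (x 4) (insert (x 0) X)) := by
        simp [p2, hx.inj.eq_iff]
      have i3 := ins1 G _ (x 3) (x 4) n3' (by simp) (hx.adj 3)
      have i2 := ins2 G _ (x 2) (x 3) (x 1) n2 (by simp) (hx.adj 2) (by simp [p1]) (hx.adj 1).symm
        (ne _ _ (by decide))
      by_cases hu : insert (x 2) (insert (x 3) (insert (x 4) (insert (x 0) X))) = Finset.univ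
      · have hyX : y2 ∈ insert (x 2) (insert (x 3) (insert (x 4) (insert (x 0) X))) := by
          rw [hu]; simp
        have hyX' : y2 ∈ X := by
          simp only [Finset.mem_insert] at hyX
          rcases hyX with p | p | p | p | p
          · exact absurd p.symm (h2.2 _)
          · exact absurd p.symm (h2.2 _)
          · exact absurd p.symm (h2.2 _)
          · exact absurd p.symm (h2.2 _)
          · exact p
        have i2' := ins3 G _ (x 2) (x 3) (x 1) y2 n2 (by simp) (hx.adj 2) (by simp [p1])
          (hx.adj 1).symm (by simp [hyX']) h2.1 (ne _ _ (by decide)) (h2.2 _) (h2.2 _)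
        have := pp_univ h
        rw [← hu] at this
        linarith
      · have := pp_ge h _ (by simp) hu
        linarith
  have i0 := ins1 G _ (x 0) y0 n0 m0 h0.1
  have p2 : x 2 ∉ X := by
    intro p2
    have i3 := ins2 G _ (x 3) (x 4) (x 2) n3' (by simp) (hx.adj 3) (by simp [p2])
        (hx.adj 2).symm (ne _ _ (by decide))
    have n1 : x 1 ∉ insert (x 3) (insert (x 4) (insert (x 0) X)) := by
        simp [p1, hx.inj.eq_iff]
    have i1 := ins3 G _ (x 1) (x 0) (x 2) y1 n1 (by simp) (hx.adj 0).symm (by simp [p2]) (hx.adj 1)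
      (by simp [m1]) h1.1 (ne _ _ (by decide)) (h1.2 _) (h1.2 _)
    have := pp_ge_two h _ (Finset.insert_nonempty (x 1) (insert (x 3) (insert (x 4) (insert (x 0) X))))
    linarith
  obtain ⟨z, b, hzK, hz0, hz1, a0, a1, a2, b0, b1, b2, hbK, hyb, hcov, hbz, -⟩ :=
    core h hx y0 y1 y2 h0 h1 2 (Or.inl rfl) h2 X (by
      intro i
      rcases fin5_cases i with rfl | rfl | rfl | rfl | rfl <;> assumption) m0 m1 hX
  have hbz := hbz rfl
  have := isoOf (G := G) E1 ![x 0, x 4, x 3, x 2, y2, b, y1, z, y0, x 1] ?_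
    (adjSymm E1 E1r E1_adj _ ?_) ?_
  · obtain ⟨e⟩ := this
    exact h.2.2.1.false e
  · have hy' := hy.symm
    have z0 := hz0.ne
    have z1 := hz1.ne
    have z0' := hz0.ne.symm
    have z1' := hz1.ne.symm
    have k0 := h0.2
    have k1 := h1.2
    have k3 := h2.2
    have k0' := fun i => (h0.2 i).symm
    have k1' := fun i => (h1.2 i).symm
    have k3' := fun i => (h2.2 i).symm
    have hzK' := fun i => (hzK i).symm
    have hbK' := fun i => (hbK i).symm
    constructor
    · intro i j
      fin_cases i <;> fin_cases j <;>
        simp [hx.inj.eq_iff, hy, hy', z0, z1, z0', z1', k0, k1, k3, k0', k1', k3', hzK, hzK', hbK, hbK', a0, a1, a2, a0.symm, a1.symm, a2.symm, b0, b1, b2, b0.symm, b1.symm, b2.symm, hyb.ne, hyb.ne.symm]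
    · intro v
      rcases hcov v with ⟨i, rfl⟩ | rfl | rfl | rfl | rfl | rfl
      · rcases fin5_cases i with rfl | rfl | rfl | rfl | rfl
        · exact ⟨0, rfl⟩
        · exact ⟨9, rfl⟩
        · exact ⟨3, rfl⟩
        · exact ⟨2, rfl⟩
        · exact ⟨1, rfl⟩
      · exact ⟨8, rfl⟩
      · exact ⟨6, rfl⟩
      · exact ⟨7, rfl⟩
      · exact ⟨4, rfl⟩
      · exact ⟨5, rfl⟩
  · intro i j hij
    unfold E1r at hij
    rcases hij with ⟨rfl, rfl⟩ | ⟨rfl, rfl⟩ | ⟨rfl, rfl⟩ | ⟨rfl, rfl⟩ | ⟨rfl, rfl⟩ | ⟨rfl, rfl⟩ |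
      ⟨rfl, rfl⟩ | ⟨rfl, rfl⟩ | ⟨rfl, rfl⟩ | ⟨rfl, rfl⟩ | ⟨rfl, rfl⟩ | ⟨rfl, rfl⟩
    · exact (hx.adj 4).symm
    · exact (hx.adj 3).symm
    · exact (hx.adj 2).symm
    · exact h2.1
    · exact hyb
    · exact hbz
    · exact hz1.symm
    · exact hz0
    · exact h0.1.symm
    · exact (hx.adj 0).symm
    · exact hx.adj 1
    · exact h1.1
  · rw [E1_pot]
    linarith [pp_univ h]


open Classical in
lemma ext1 {V : Type} [Fintype V] {G : SimpleGraph V} (h : SmallestCex G) (D : Finset V)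
    (hne : D.Nonempty) : ∃ f : V → Fin 5, IsCol G Dᶜ f ∧ ∀ g : V → Fin 5,
      (∀ v, v ∉ D → g v = f v) → (∀ u ∈ D, ∀ v, G.Adj u v → A5 (g u) (g v)) → False := by
  obtain ⟨f, hf⟩ := col_of_ne h.1 Dᶜ (by
    intro h0
    obtain ⟨d, hd⟩ := hne
    have : d ∈ Dᶜ := by rw [h0]; simp
    simp at this
    exact this hd)
  refine ⟨f, hf, fun g hg hD => noCol_univ h.1.1 g ?_⟩
  intro u _ v _ huv
  by_cases hu : u ∈ D
  · exact hD u hu v huv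
  · by_cases hv : v ∈ D
    · exact A5_symm (hD v hv u huv.symm)
    · rw [hg u hu, hg v hv]
      exact hf u (by simpa using hu) v (by simpa using hv) huv

lemma deg_ge_two {V : Type} [Fintype V] {G : SimpleGraph V} (h : SmallestCex G) (v : V) :
    2 ≤ deg G v := by
  classical
  by_contra hlt
  have : ∃ a, ∀ z, G.Adj v z → z = a := by
    by_cases h0 : ∃ a, G.Adj v a
    · obtain ⟨a, ha⟩ := h0
      refine ⟨a, fun z hz => ?_⟩
      have h1 : (G.neighborSet v).ncard ≤ 1 := by unfold deg at hlt; omega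
      exact (Set.ncard_le_one (Set.toFinite _)).1 h1 z hz a ha
    · exact ⟨v, fun z hz => (h0 ⟨z, hz⟩).elim⟩
  obtain ⟨a, ha⟩ := this
  obtain ⟨f, _, hext⟩ := ext1 h {v} (by simp)
  apply hext (Function.update f v (f a + 1))
  · intro u hu
    simp at hu
    simp [hu]
  · intro u hu z hz
    simp at hu
    subst hu
    have := ha z hz
    subst this
    rw [Function.update_self, Function.update_of_ne hz.ne']
    left; exact add_sub_cancel_left _ _

lemma deg_two_nbr {V : Type} [Fintype V] {G : SimpleGraph V} (h : SmallestCex G) (v a : V)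
    (hva : G.Adj v a) (h3 : ¬ 3 ≤ deg G v) : deg G v = 2 ∧
    ∃ b, b ≠ a ∧ G.Adj v b ∧ ∀ z, G.Adj v z → z = a ∨ z = b := by
  have h2 : deg G v = 2 := by have := deg_ge_two h v; omega
  refine ⟨h2, ?_⟩
  unfold deg at h2
  obtain ⟨p, q, hpq, hs⟩ := Set.ncard_eq_two.1 h2
  have hm : ∀ z, G.Adj v z ↔ z = p ∨ z = q := by
    intro z
    rw [← SimpleGraph.mem_neighborSet, hs]
    simp
  rcases (hm a).1 hva with rfl | rfl
  · exact ⟨q, hpq.symm, (hm q).2 (Or.inr rfl), fun z hz => (hm z).1 hz⟩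
  · exact ⟨p, hpq, (hm p).2 (Or.inl rfl), fun z hz => ((hm z).1 hz).symm⟩

lemma deg_ge_three {V : Type} [Fintype V] {G : SimpleGraph V} (v a b c : V)
    (ha : G.Adj v a) (hb : G.Adj v b) (hc : G.Adj v c) (hab : a ≠ b) (hac : a ≠ c) (hbc : b ≠ c) :
    3 ≤ deg G v := by
  unfold deg
  have : ({a, b, c} : Set V).ncard = 3 := Set.ncard_eq_three.2 ⟨a, b, c, hab, hac, hbc, rfl⟩
  rw [← this]
  apply Set.ncard_le_ncard _ (Set.toFinite _)
  intro z hz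
  rcases hz with rfl | rfl | rfl <;> assumption

lemma Out.deg {V : Type} [Fintype V] {G : SimpleGraph V} {x : Fin 5 → V}
    (hx : Cell G x) {i : Fin 5} {y : V} (ho : Out G x i y) : 3 ≤ deg G (x i) := by
  apply deg_ge_three (x i) (x (i + 1)) (x (i - 1)) y (hx.adj i) _ ho.1 _ (ho.2 _) (ho.2 _)
  · exact hx.adj' _ _ (by left; exact sub_sub_cancel _ _)
  · intro h0
    have := hx.inj h0
    clear h0 ho
    revert this
    revert i
    decide

lemma walk2 : ∀ a b : Fin 5, a ≠ b → ¬ A5 a b → ∃ p, A5 a p ∧ A5 p b := by decide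
lemma walk3 : ∀ a b : Fin 5, a ≠ b → ∃ p q, A5 a p ∧ A5 p q ∧ A5 q b := by decide
lemma walk4 : ∀ a b : Fin 5, ∃ p q r, A5 a p ∧ A5 p q ∧ A5 q r ∧ A5 r b := by decide

/-- no three consecutive degree two vertices -/
lemma no_three {V : Type} [Fintype V] {G : SimpleGraph V} (h : SmallestCex G)
    (v y1 y2 y3 y4 : V) (h12 : y1 ≠ y2) (h13 : y1 ≠ y3) (h23 : y2 ≠ y3)
    (hv1 : v ≠ y1) (hv2 : v ≠ y2) (hv3 : v ≠ y3) (h41 : y4 ≠ y1) (h42 : y4 ≠ y2) (h43 : y4 ≠ y3)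
    (n1 : ∀ z, G.Adj y1 z → z = v ∨ z = y2) (n2 : ∀ z, G.Adj y2 z → z = y1 ∨ z = y3)
    (n3 : ∀ z, G.Adj y3 z → z = y2 ∨ z = y4) : False := by
  classical
  obtain ⟨f, _, hext⟩ := ext1 h {y1, y2, y3} (by simp)
  obtain ⟨p, q, r, h1, h2, h3, h4⟩ := walk4 (f v) (f y4)
  apply hext (fun z => if z = y1 then p else if z = y2 then q else if z = y3 then r else f z)
  · intro z hz
    simp only [Finset.mem_insert, Finset.mem_singleton, not_or] at hz
    simp [hz]
  · intro u hu z hz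
    simp only [Finset.mem_insert, Finset.mem_singleton] at hu
    rcases hu with rfl | rfl | rfl
    · rcases n1 z hz with rfl | rfl
      · simpa [hv1, hv2, hv3] using A5_symm h1
      · simpa [h12.symm] using h2
    · rcases n2 z hz with rfl | rfl
      · simpa [h12.symm] using A5_symm h2
      · simpa [h12.symm, h13.symm, h23.symm] using h3
    · rcases n3 z hz with rfl | rfl
      · simpa [h12.symm, h13.symm, h23.symm] using A5_symm h3
      · simpa [h41, h42, h43, h13.symm, h23.symm] using h4

lemma c5_hom_dec : ∀ a b : Fin 5, A5 a b → ∀ i j : Fin 5,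
    (A5 (![a, b, 2 * b - a, 3 * b - 2 * a, 4 * b - 3 * a] i)
      (![a, b, 2 * b - a, 3 * b - 2 * a, 4 * b - 3 * a] j) → A5 i j) ∧
    (![a, b, 2 * b - a, 3 * b - 2 * a, 4 * b - 3 * a] i =
      ![a, b, 2 * b - a, 3 * b - 2 * a, 4 * b - 3 * a] j → i = j) := by
  decide +kernel

lemma c5_hom (g : Fin 5 → Fin 5) (hg : ∀ k, A5 (g k) (g (k + 1))) (i j : Fin 5) :
    (A5 (g i) (g j) → A5 i j) ∧ (g i = g j → i = j) := by
  obtain ⟨h2, h3, h4⟩ := c5_form (g 0) (g 1) (g 2) (g 3) (g 4) (hg 0) (hg 1) (hg 2) (hg 3) (hg 4)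
  have hh : g = ![g 0, g 1, 2 * g 1 - g 0, 3 * g 1 - 2 * g 0, 4 * g 1 - 3 * g 0] := by
    funext k
    rcases fin5_cases k with rfl | rfl | rfl | rfl | rfl
    · rfl
    · rfl
    · exact h2
    · exact h3
    · exact h4
  have := c5_hom_dec (g 0) (g 1) (hg 0) i j
  rw [← hh] at this
  exact this

/-- no cell chord through two degree two vertices -/
lemma no_two {V : Type} [Fintype V] {G : SimpleGraph V} (h : SmallestCex G)
    {x : Fin 5 → V} (hx : Cell G x) (i j : Fin 5) (hij : i ≠ j)
    (y1 y2 : V) (h12 : y1 ≠ y2) (hy1 : ∀ k, x k ≠ y1) (hy2 : ∀ k, x k ≠ y2)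
    (n1 : ∀ z, G.Adj y1 z → z = x i ∨ z = y2) (n2 : ∀ z, G.Adj y2 z → z = y1 ∨ z = x j) :
    False := by
  classical
  obtain ⟨f, hf, hext⟩ := ext1 h {y1, y2} (by simp)
  have hinj : Function.Injective (fun k => f (x k)) := by
    intro a b
    refine (c5_hom (fun k => f (x k)) (fun k => ?_) a b).2
    exact hf _ (by simp [hy1 k, hy2 k]) _ (by simp [hy1 (k + 1), hy2 (k + 1)]) (hx.adj k)
  obtain ⟨p, q, h1, h2, h3⟩ := walk3 (f (x i)) (f (x j)) (fun h0 => hij (hinj h0))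
  apply hext (fun z => if z = y1 then p else if z = y2 then q else f z)
  · intro z hz
    simp only [Finset.mem_insert, Finset.mem_singleton, not_or] at hz
    simp [hz]
  · intro u hu z hz
    simp only [Finset.mem_insert, Finset.mem_singleton] at hu
    rcases hu with rfl | rfl
    · rcases n1 z hz with rfl | rfl
      · simpa [hy1 i, hy2 i] using A5_symm h1
      · simpa [h12.symm] using h2
    · rcases n2 z hz with rfl | rfl
      · simpa [h12.symm] using A5_symm h2
      · simpa [h12.symm, hy1 j, hy2 j] using h3

/-- no cell chord through one degree two vertex -/
lemma no_one {V : Type} [Fintype V] {G : SimpleGraph V} (h : SmallestCex G)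
    {x : Fin 5 → V} (hx : Cell G x) (i j : Fin 5) (hij : i ≠ j) (hA : ¬ A5 i j)
    (y1 : V) (hy1 : ∀ k, x k ≠ y1) 
    (n1 : ∀ z, G.Adj y1 z → z = x i ∨ z = x j) : False := by
  classical
  obtain ⟨f, hf, hext⟩ := ext1 h {y1} (by simp)
  have hadj : ∀ k, A5 (f (x k)) (f (x (k + 1))) := fun k => 
    hf _ (by simp [hy1 k]) _ (by simp [hy1 (k + 1)]) (hx.adj k)
  have hinj : Function.Injective (fun k => f (x k)) := fun a b => (c5_hom (fun k => f (x k)) hadj a b).2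
  have hna : ¬ A5 (f (x i)) (f (x j)) := fun h0 => hA ((c5_hom (fun k => f (x k)) hadj i j).1 h0)
  obtain ⟨p, h1, h2⟩ := walk2 (f (x i)) (f (x j)) (fun h0 => hij (hinj h0)) hna
  apply hext (fun z => if z = y1 then p else f z)
  · intro z hz
    simp only [Finset.mem_singleton] at hz
    simp [hz]
  · intro u hu z hz
    simp only [Finset.mem_singleton] at hu
    subst hu
    rcases n1 z hz with rfl | rfl
    · simpa [hy1 i] using A5_symm h1
    · simpa [hy1 j] using h2


lemma out_string {V : Type} [Fintype V] {G : SimpleGraph V} (h : SmallestCex G)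
    {x : Fin 5 → V} (hx : Cell G x) (i : Fin 5) (y : V) (ho : Out G x i y) :
    ∃ (u v : V) (p : G.Walk u v), IsString G p ∧ s(x i, y) ∈ p.edges ∧ x i ∈ p.support ∧
      ∀ j z, Out G x j z → s(x j, z) ∈ p.edges → s(x j, z) = s(x i, y) := by
  have hd := ho.deg hx
  have hadj := ho.1
  have hxy := ho.2
  by_cases d1 : 3 ≤ deg G y
  · refine ⟨x i, y, .cons hadj .nil, ⟨?_, ?_, hd, d1, ?_⟩, ?_, ?_, ?_⟩
    · simp [hadj.ne]
    · simp
    · intro w hw h1 h2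
      simp at hw
      tauto
    · simp
    · simp
    · intro j z _ hm
      simpa using hm
  obtain ⟨e1, y2, ne1, a12, n1⟩ := deg_two_nbr h y (x i) hadj.symm d1
  by_cases d2 : 3 ≤ deg G y2
  · refine ⟨x i, y2, .cons hadj (.cons a12 .nil), ⟨?_, ?_, hd, d2, ?_⟩, ?_, ?_, ?_⟩
    · simp [hadj.ne, a12.ne, ne1.symm]
    · simp
    · intro w hw h1 h2
      simp at hw
      rcases hw with rfl | rfl | rfl
      · exact absurd rfl h1
      · exact e1
      · exact absurd rfl h2
    · simp
    · simp
    · intro j z hz hm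
      simp only [Walk.edges_cons, Walk.edges_nil, List.mem_cons, List.not_mem_nil, or_false] at hm
      rcases hm with hm | hm
      · exact hm
      exfalso
      rw [Sym2.eq_iff] at hm
      rcases hm with ⟨h1, _⟩ | ⟨h1, _⟩
      · exact hxy j h1
      · subst h1
        refine no_one h hx i j (fun h0 => ne1 (by rw [h0])) (fun hA => ?_) y hxy n1
        exact noTri h (x i) y (x j) hadj a12 (hx.adj' _ _ hA)
  obtain ⟨e2, y3, ne2, a23, n2⟩ := deg_two_nbr h y2 y a12.symm d2
  have ne3 : y3 ≠ x i := by
    rintro rfl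
    exact noTri h _ _ _ hadj a12 a23.symm
  by_cases d3 : 3 ≤ deg G y3
  · refine ⟨x i, y3, .cons hadj (.cons a12 (.cons a23 .nil)), ⟨?_, ?_, hd, d3, ?_⟩, ?_, ?_, ?_⟩
    · simp [hadj.ne, a12.ne, a23.ne, ne1.symm, ne2.symm, ne3.symm]
    · simp
    · intro w hw h1 h2
      simp at hw
      rcases hw with rfl | rfl | rfl | rfl
      · exact absurd rfl h1
      · exact e1
      · exact e2
      · exact absurd rfl h2
    · simp
    · simp
    · intro j z hz hm
      simp only [Walk.edges_cons, Walk.edges_nil, List.mem_cons, List.not_mem_nil, or_false] at hm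
      have hj := hz.deg hx
      rcases hm with hm | hm | hm
      · exact hm
      · exfalso
        rw [Sym2.eq_iff] at hm
        rcases hm with ⟨h1, _⟩ | ⟨h1, _⟩
        · exact hxy j h1
        · rw [h1] at hj
          exact d2 hj
      · exfalso
        rw [Sym2.eq_iff] at hm
        rcases hm with ⟨h1, _⟩ | ⟨h1, h2⟩
        · rw [h1] at hj
          exact d2 hj
        · subst h1
          subst h2
          exact no_two h hx i j (fun h0 => ne3 (by rw [h0])) y z a12.ne hxy hz.2 n1 n2
  exfalso
  obtain ⟨e3, y4, ne4, a34, n3⟩ := deg_two_nbr h y3 y2 a23.symm d3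
  refine no_three h (x i) y y2 y3 y4 a12.ne ne2.symm a23.ne hadj.ne ne1.symm ne3.symm ?_ ne4
    a34.ne' n1 n2 n3
  rintro rfl
  rcases n1 y3 a34.symm with h0 | h0
  · exact ne3 h0
  · exact a23.ne h0.symm

lemma out_count {V : Type} [Fintype V] {G : SimpleGraph V} (h : SmallestCex G)
    {x : Fin 5 → V} (hx : Cell G x) {w : V} (c : G.Walk w w)
    (hc : ∀ v, v ∈ c.support ↔ ∃ i, x i = v) :
    {q : Fin 5 × V | Out G x q.1 q.2}.ncard ≤ cellDegree G c := by
  have key : ∀ q : Fin 5 × V, Out G x q.1 q.2 → ∃ S : Set (Sym2 V),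
      (∃ (u v : V) (p : G.Walk u v), IsString G p ∧ S = {e | e ∈ p.edges} ∧
        ¬ S ⊆ {e | e ∈ c.edges} ∧ ∃ x ∈ p.support, x ∈ c.support) ∧
      s(x q.1, q.2) ∈ S ∧ ∀ j z, Out G x j z → s(x j, z) ∈ S → s(x j, z) = s(x q.1, q.2) := by
    rintro ⟨i, y⟩ ho
    obtain ⟨u, v, p, hp, hm, hs, hu⟩ := out_string h hx i y ho
    refine ⟨{e | e ∈ p.edges}, ⟨u, v, p, hp, rfl, ?_, x i, hs, (hc _).2 ⟨i, rfl⟩⟩, hm, hu⟩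
    intro hsub
    have h1 : s(x i, y) ∈ c.edges := hsub hm
    obtain ⟨j, hj⟩ := (hc y).1 (c.snd_mem_support_of_mem_edges h1)
    exact ho.2 j hj
  choose! F hF using key
  unfold cellDegree
  apply Set.ncard_le_ncard_of_injOn F
  · intro q hq
    exact (hF q hq).1
  · rintro ⟨i, y⟩ hq ⟨j, z⟩ hr he
    have h1 := (hF _ hr).2.1
    rw [← he] at h1
    have h2 := (hF _ hq).2.2 j z hr h1
    simp only [Sym2.eq_iff] at h2
    rcases h2 with ⟨h2, h3⟩ | ⟨h2, h3⟩
    · rw [hx.inj h2, h3]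
    · exact absurd h2 (hq.2 j)

lemma out_sum {V : Type} [Fintype V] {G : SimpleGraph V} (x : Fin 5 → V) :
    {y | Out G x 0 y}.ncard + {y | Out G x 1 y}.ncard + {y | Out G x 2 y}.ncard +
    {y | Out G x 3 y}.ncard + {y | Out G x 4 y}.ncard = 
    {q : Fin 5 × V | Out G x q.1 q.2}.ncard := by
  classical
  have : {q : Fin 5 × V | Out G x q.1 q.2}.ncard = ∑ i : Fin 5, {y | Out G x i y}.ncard := by
    rw [Set.ncard_eq_toFinset_card', Finset.card_eq_sum_card_fiberwise (f := Prod.fst)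
      (t := Finset.univ) (by simp)]
    apply Finset.sum_congr rfl
    intro i _
    rw [Set.ncard_eq_toFinset_card']
    symm
    apply Finset.card_bij (fun y _ => (i, y))
    · intro y hy
      simpa using hy
    · intro a _ b _ hab
      simpa using hab
    · rintro ⟨j, y⟩ hy
      simp at hy
      obtain ⟨h1, rfl⟩ := hy
      exact ⟨y, by simpa using h1, rfl⟩
  rw [this, Fin.sum_univ_five]

lemma cell_of_cycle {V : Type} {G : SimpleGraph V} {w : V} (c : G.Walk w w) (hc : c.IsCycle)
    (hl : c.length = 5) : ∃ x : Fin 5 → V, Cell G x ∧ ∀ v, v ∈ c.support ↔ ∃ i, x i = v := by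
  have h50 : c.getVert 5 = c.getVert 0 := by
    rw [← hl, Walk.getVert_length, Walk.getVert_zero]
  refine ⟨fun i => c.getVert i.val, ⟨?_, ?_⟩, ?_⟩
  · intro i j hij
    have := hc.getVert_injOn' (x₁ := i.val) (x₂ := j.val)
      (by simp only [Set.mem_ofPred_eq]; omega) (by simp only [Set.mem_ofPred_eq]; omega) hij
    exact Fin.ext this
  · intro i
    have := c.adj_getVert_succ (i := i.val) (by omega)
    rcases fin5_cases i with rfl | rfl | rfl | rfl | rfl
    · exact this
    · exact this
    · exact this
    · exact this
    · have h2 : G.Adj (c.getVert 4) (c.getVert 5) := this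
      rw [h50] at h2
      exact h2
  · intro v
    rw [Walk.mem_support_iff_exists_getVert]
    constructor
    · rintro ⟨n, h1, h2⟩
      rw [hl] at h2
      by_cases h5 : n = 5
      · subst h5
        exact ⟨0, by rw [← h1, h50]; rfl⟩
      · exact ⟨⟨n, by omega⟩, h1⟩
    · rintro ⟨i, hi⟩
      exact ⟨i.val, hi, by omega⟩

/-- the five configurations of outgoing degrees around the cell, after a rotation by `k` -/
abbrev Conf (d : Fin 5 → ℕ) (k : Fin 5) : Prop :=
  (d (k + 2) = 0 ∧ d (k + 3) = 0 ∧ d (k + 4) = 0) ∨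
  (d (k + 1) = 0 ∧ d (k + 3) = 0 ∧ d (k + 4) = 0 ∧ d (k + 2) = 1) ∨
  (d (k + -1) = 0 ∧ d (k + -3) = 0 ∧ d (k + -4) = 0 ∧ d (k + -2) = 1) ∨
  (d (k + 2) = 0 ∧ d (k + 4) = 0 ∧ d (k + 0) = 1 ∧ d (k + 1) = 1 ∧ d (k + 3) = 1) ∨
  (d (k + 3) = 0 ∧ d (k + 4) = 0 ∧ d (k + 0) = 1 ∧ d (k + 1) = 1 ∧ d (k + 2) = 1)

lemma numeric_dec : ∀ a b c e f : Fin 4, a.val + b.val + c.val + e.val + f.val ≤ 3 →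
    ∃ k, Conf ![a.val, b.val, c.val, e.val, f.val] k := by
  decide +kernel

lemma numeric (d : Fin 5 → ℕ) (hd : d 0 + d 1 + d 2 + d 3 + d 4 ≤ 3) : ∃ k, Conf d k := by
  have := numeric_dec ⟨d 0, by omega⟩ ⟨d 1, by omega⟩ ⟨d 2, by omega⟩ ⟨d 3, by omega⟩
    ⟨d 4, by omega⟩ hd
  have hh : d = ![d 0, d 1, d 2, d 3, d 4] := by
    funext k
    rcases fin5_cases k with rfl | rfl | rfl | rfl | rfl <;> rfl
  rw [hh]
  exact this

lemma out_rot {V : Type} {G : SimpleGraph V} {x : Fin 5 → V} (k i : Fin 5) (y : V) :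
    Out G (fun i => x (k + i)) i y ↔ Out G x (k + i) y := by
  refine and_congr Iff.rfl ⟨fun h j => ?_, fun h j => h _⟩
  have := h (j - k)
  simpa using this

lemma out_refl {V : Type} {G : SimpleGraph V} {x : Fin 5 → V} (k i : Fin 5)
    (y : V) : Out G (fun i => x (k + -i)) i y ↔ Out G x (k + -i) y := by
  refine and_congr Iff.rfl ⟨fun h j => ?_, fun h j => h _⟩
  have := h (k - j)
  simpa using this

lemma finish {V : Type} [Fintype V] {G : SimpleGraph V} (h : SmallestCex G)
    {x : Fin 5 → V} (hx : Cell G x)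
    (hs : {y | Out G x 0 y}.ncard + {y | Out G x 1 y}.ncard + {y | Out G x 2 y}.ncard +
    {y | Out G x 3 y}.ncard + {y | Out G x 4 y}.ncard ≤ 3) : False := by
  have z0 : ∀ i, {y | Out G x i y}.ncard = 0 → ∀ y, ¬ Out G x i y := by
    intro i hi y hy
    rw [Set.ncard_eq_zero (Set.toFinite _)] at hi
    have : y ∈ {y | Out G x i y} := hy
    rw [hi] at this
    exact this
  have z1 : ∀ i, {y | Out G x i y}.ncard = 1 →
      ∃ y0, Out G x i y0 ∧ ∀ y, Out G x i y → y = y0 := by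
    intro i hi
    obtain ⟨a, ha⟩ := Set.ncard_eq_one.1 hi
    have hm : ∀ y, Out G x i y ↔ y = a := fun y => by
      have := Set.ext_iff.1 ha y
      simpa using this
    exact ⟨a, (hm a).2 rfl, fun y hy => (hm y).1 hy⟩
  -- rotations and reflections
  have kD : ∀ k : Fin 5, {y | Out G x (k + 2) y}.ncard = 0 → {y | Out G x (k + 3) y}.ncard = 0 →
      {y | Out G x (k + 4) y}.ncard = 0 → False := fun k a b c =>
    caseD h (hx.rot k)
      (fun y o => z0 _ a y
      ((out_rot k _ y).1 o))
      (fun y o => z0 _ b y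
      ((out_rot k _ y).1 o))
      (fun y o => z0 _ c y
      ((out_rot k _ y).1 o))
  have kC : ∀ k : Fin 5, {y | Out G x (k + 1) y}.ncard = 0 → {y | Out G x (k + 3) y}.ncard = 0 →
      {y | Out G x (k + 4) y}.ncard = 0 → {y | Out G x (k + 2) y}.ncard = 1 → False := by
    intro k a b c d
    obtain ⟨y, hy, hu⟩ := z1 _ d
    exact caseC h (hx.rot k)
      (fun y o => z0 _ a y
      ((out_rot k _ y).1 o))
      (fun y o => z0 _ b y
      ((out_rot k _ y).1 o))
      (fun y o => z0 _ c y
      ((out_rot k _ y).1 o)) y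
      ((out_rot k _ _).2 hy)
      (fun y o => hu y
      ((out_rot k _ y).1 o))
  have kC' : ∀ k : Fin 5, {y | Out G x (k + -1) y}.ncard = 0 →
      {y | Out G x (k + -3) y}.ncard = 0 →
      {y | Out G x (k + -4) y}.ncard = 0 → {y | Out G x (k + -2) y}.ncard = 1 → False := by
    intro k a b c d
    obtain ⟨y, hy, hu⟩ := z1 _ d
    exact caseC h (hx.rot k).refl
      (fun y o => z0 _ a y
      ((out_refl k _ y).1 o))
      (fun y o => z0 _ b y
      ((out_refl k _ y).1 o))
      (fun y o => z0 _ c y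
      ((out_refl k _ y).1 o)) y
      ((out_refl k _ _).2 hy)
      (fun y o => hu y
      ((out_refl k _ y).1 o))
  have kB : ∀ k : Fin 5, {y | Out G x (k + 2) y}.ncard = 0 → {y | Out G x (k + 4) y}.ncard = 0 →
      {y | Out G x (k + 0) y}.ncard = 1 → {y | Out G x (k + 1) y}.ncard = 1 →
      {y | Out G x (k + 3) y}.ncard = 1 → False := by
    intro k a b c d e
    obtain ⟨y0, hy0, hu0⟩ := z1 _ c
    obtain ⟨y1, hy1, hu1⟩ := z1 _ d
    obtain ⟨y3, hy3, hu3⟩ := z1 _ e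
    exact caseB h (hx.rot k)
      (fun y o => z0 _ a y
      ((out_rot k _ y).1 o))
      (fun y o => z0 _ b y
      ((out_rot k _ y).1 o)) y0 y1 y3
      ((out_rot k _ _).2 hy0)
      ((out_rot k _ _).2 hy1)
      ((out_rot k _ _).2 hy3)
      (fun y o => hu0 y
      ((out_rot k _ y).1 o))
      (fun y o => hu1 y
      ((out_rot k _ y).1 o))
      (fun y o => hu3 y
      ((out_rot k _ y).1 o))
  have kA : ∀ k : Fin 5, {y | Out G x (k + 3) y}.ncard = 0 → {y | Out G x (k + 4) y}.ncard = 0 →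
      {y | Out G x (k + 0) y}.ncard = 1 → {y | Out G x (k + 1) y}.ncard = 1 →
      {y | Out G x (k + 2) y}.ncard = 1 → False := by
    intro k a b c d e
    obtain ⟨y0, hy0, hu0⟩ := z1 _ c
    obtain ⟨y1, hy1, hu1⟩ := z1 _ d
    obtain ⟨y3, hy3, hu3⟩ := z1 _ e
    exact caseA h (hx.rot k)
      (fun y o => z0 _ a y
      ((out_rot k _ y).1 o))
      (fun y o => z0 _ b y
      ((out_rot k _ y).1 o)) y0 y1 y3
      ((out_rot k _ _).2 hy0)
      ((out_rot k _ _).2 hy1)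
      ((out_rot k _ _).2 hy3)
      (fun y o => hu0 y
      ((out_rot k _ y).1 o))
      (fun y o => hu1 y
      ((out_rot k _ y).1 o))
      (fun y o => hu3 y
      ((out_rot k _ y).1 o))
  obtain ⟨k, hk⟩ := numeric (fun i => {y | Out G x i y}.ncard) hs
  rcases hk with hk | hk | hk | hk | hk
  · exact kD k hk.1 hk.2.1 hk.2.2
  · exact kC k hk.1 hk.2.1 hk.2.2.1 hk.2.2.2
  · exact kC' k hk.1 hk.2.1 hk.2.2.1 hk.2.2.2
  · exact kB k hk.1 hk.2.1 hk.2.2.1 hk.2.2.2.1 hk.2.2.2.2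
  · exact kA k hk.1 hk.2.1 hk.2.2.1 hk.2.2.2.1 hk.2.2.2.2

/-- A smallest counterexample contains no 5-cycle (cell) of degree
at most three. -/
theorem smallestCex_no_cell_degree_le_three {V : Type} [Fintype V] (G : SimpleGraph V)
    (h : SmallestCex G) :
    ∀ (w : V) (c : G.Walk w w), c.IsCycle → c.length = 5 → ¬ cellDegree G c ≤ 3 := by
  intro w c hc hl h3
  obtain ⟨x, hx, hs⟩ := cell_of_cycle c hc hl
  have h1 := out_count h hx c hs
  rw [← out_sum] at h1
  exact finish h hx (h1.trans h3)
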